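/- Let k be an algebraically closed field and let S = V(f) ⊆ P³ be a smooth surface of degree d ≥ 3 containing exactly d²(d²−3d+3) lines. Then d−1 is a prime power, and S contains a numerical star chord pair configuration: there exist pairwise distinct planes H₁,…,H_d, K₁,…,K_d (3-dimensional subspaces of k⁴) such that all d² subspaces Lᵢⱼ = Hᵢ ∩ Kⱼ (1 ≤ i,j ≤ d) are pairwise distinct lines, each lying on S. -/

import Mathlib

open MvPolynomial

/-- `W` is a line (2-dimensional linear subspace of `k⁴`) lying on the surface `V(f) ⊆ P³`. -/
def IsLineOn {k : Type*} [Field k] (f : MvPolynomial (Fin 4) k)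
    (W : Submodule k (Fin 4 → k)) : Prop :=
  Module.finrank k W = 2 ∧ ∀ v ∈ W, MvPolynomial.eval v f = 0

/-- `f` is a nonzero homogeneous polynomial of degree `d` in `k[x,y,z,w]` such that `f` and its
four partial derivatives have no common zero in `k⁴ ∖ {0}`; i.e. `V(f) ⊆ P³` is a smooth
surface of degree `d`. -/
def IsSmoothSurface {k : Type*} [Field k] (f : MvPolynomial (Fin 4) k) (d : ℕ) : Prop :=
  f ≠ 0 ∧ f.IsHomogeneous d ∧
    ∀ v : Fin 4 → k, v ≠ 0 →
      ¬ (MvPolynomial.eval v f = 0 ∧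
         ∀ i : Fin 4, MvPolynomial.eval v (MvPolynomial.pderiv i f) = 0)

/-- A numerical star chord pair configuration on `S = V(f)`: pairwise distinct planes
`H₁,…,H_d, K₁,…,K_d` (3-dimensional subspaces of `k⁴`) such that the `d²` subspaces
`Lᵢⱼ = Hᵢ ⊓ Kⱼ` are pairwise distinct lines, each lying on `S`. -/
def IsNSCPairConfig {k : Type*} [Field k] {d : ℕ} (f : MvPolynomial (Fin 4) k)
    (H K : Fin d → Submodule k (Fin 4 → k)) : Prop :=
  (∀ i, Module.finrank k (H i) = 3) ∧ (∀ i, Module.finrank k (K i) = 3) ∧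
  Function.Injective H ∧ Function.Injective K ∧ (∀ i j, H i ≠ K j) ∧
  (∀ i j m n, H i ⊓ K j = H m ⊓ K n → i = m ∧ j = n) ∧
  (∀ i j, IsLineOn f (H i ⊓ K j))

section Restriction

variable {k A B σ : Type*} [CommRing k] [CommRing A] [CommRing B] [Algebra k A] [Algebra k B]

/-- The polynomial `t ↦ f (v + t u)`. -/
noncomputable def lineRestr (f : MvPolynomial σ k) (v u : σ → A) : Polynomial A :=
  aeval (fun j => Polynomial.C (v j) + Polynomial.X * Polynomial.C (u j)) f

/-- The directional derivative of `f` along the constant vector `e`. -/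
noncomputable def dirDeriv [Fintype σ] (f : MvPolynomial σ k) (e : σ → k) : MvPolynomial σ k :=
  ∑ j, C (e j) * pderiv j f

theorem eval_lineRestr (f : MvPolynomial σ k) (v u : σ → A) (t : A) :
    (lineRestr f v u).eval t = aeval (v + t • u) f := by
  have h : ((Polynomial.aeval t).restrictScalars k).comp
      (aeval (fun j => Polynomial.C (v j) + Polynomial.X * Polynomial.C (u j))) =
      (aeval (v + t • u) : MvPolynomial σ k →ₐ[k] A) := by
    apply MvPolynomial.algHom_ext
    intro i
    simp
    exact mul_comm _ _
  have := DFunLike.congr_fun h f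
  simpa [lineRestr, Polynomial.coe_aeval_eq_eval] using this

theorem coeff_zero_lineRestr (f : MvPolynomial σ k) (v u : σ → A) :
    (lineRestr f v u).coeff 0 = aeval v f := by
  rw [Polynomial.coeff_zero_eq_eval_zero, eval_lineRestr]
  simp

theorem coeff_one_lineRestr [Fintype σ] (f : MvPolynomial σ k) (v u : σ → A) :
    (lineRestr f v u).coeff 1 = ∑ j, u j * aeval v (pderiv j f) := by
  classical
  induction f using MvPolynomial.induction_on with
  | C a => simp [lineRestr, Polynomial.algebraMap_apply]
  | add p q hp hq =>
    simp only [lineRestr, map_add, Polynomial.coeff_add, mul_add, Finset.sum_add_distrib] at *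
    rw [hp, hq]
  | mul_X p i hp =>
    have h0 := coeff_zero_lineRestr p v u
    simp only [lineRestr, map_mul, aeval_X] at *
    rw [Polynomial.mul_coeff_one, h0, hp]
    simp only [Polynomial.coeff_add, Polynomial.coeff_C_succ, Polynomial.coeff_X_mul,
      pderiv_mul, map_add, map_mul, pderiv_X, aeval_X, mul_add, Finset.sum_add_distrib,
      Polynomial.coeff_X_mul_zero, Polynomial.coeff_C_zero]
    rw [Finset.sum_eq_single i 
      (f := fun j => u j * (aeval v p * aeval v (Pi.single (M := fun _ => MvPolynomial σ k) j 1 i)))]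
    · simp only [Pi.single_eq_same, map_one, mul_one]
      rw [add_comm, Finset.sum_mul]
      simp only [mul_comm, mul_left_comm]
      ring
    · intro b _ hb
      rw [Pi.single_eq_of_ne hb.symm]
      simp
    · simp

theorem map_lineRestr (φ : A →ₐ[k] B) (f : MvPolynomial σ k) (v u : σ → A) :
    (lineRestr f v u).map (φ : A →+* B) = lineRestr f (fun j => φ (v j)) (fun j => φ (u j)) := by
  have h : (Polynomial.mapAlgHom φ).comp
      (aeval (fun j => Polynomial.C (v j) + Polynomial.X * Polynomial.C (u j))) =
      (aeval (fun j => Polynomial.C (φ (v j)) + Polynomial.X * Polynomial.C (φ (u j))) :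
        MvPolynomial σ k →ₐ[k] Polynomial B) := by
    apply MvPolynomial.algHom_ext
    intro i
    simp
  exact DFunLike.congr_fun h f

theorem lineRestr_smul (f : MvPolynomial σ k) (v u : σ → A) (s : A) (i : ℕ) :
    (lineRestr f v (s • u)).coeff i = s ^ i * (lineRestr f v u).coeff i := by
  have h : ((Polynomial.compRingHom (Polynomial.C s * Polynomial.X : Polynomial A))).comp
      (aeval (fun j => Polynomial.C (v j) + Polynomial.X * Polynomial.C (u j)) :
        MvPolynomial σ k →ₐ[k] Polynomial A).toRingHom =
      (aeval (fun j => Polynomial.C (v j) + Polynomial.X * Polynomial.C ((s • u) j)) :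
        MvPolynomial σ k →ₐ[k] Polynomial A).toRingHom := by
    apply MvPolynomial.ringHom_ext
    · intro a
      simp [Polynomial.algebraMap_apply]
    · intro i
      simp
      ring
  have := DFunLike.congr_fun h f
  simp only [RingHom.comp_apply, Polynomial.coe_compRingHom_apply] at this
  change _ = lineRestr f v (s • u) at this
  rw [← this]
  change ((lineRestr f v u).comp _).coeff i = _
  rw [Polynomial.comp_C_mul_X_coeff, mul_comm]

theorem eval_dirDeriv_add [Fintype σ] (f : MvPolynomial σ k) (v e e' : σ → k) :
    eval v (dirDeriv f (e + e')) = eval v (dirDeriv f e) + eval v (dirDeriv f e') := by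
  simp [dirDeriv, add_mul, Finset.sum_add_distrib]

theorem eval_dirDeriv_smul [Fintype σ] (f : MvPolynomial σ k) (v e : σ → k) (s : k) :
    eval v (dirDeriv f (s • e)) = s * eval v (dirDeriv f e) := by
  simp [dirDeriv, Finset.mul_sum, mul_assoc]

theorem isHomogeneous_dirDeriv [Fintype σ] {f : MvPolynomial σ k} {d : ℕ}
    (hf : f.IsHomogeneous d) (e : σ → k) : (dirDeriv f e).IsHomogeneous (d - 1) := by
  apply IsHomogeneous.sum
  intro i _
  simpa using (isHomogeneous_C σ (e i)).mul hf.pderiv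

theorem lineRestr_good (Fil : ℕ → Submodule k B) (h1 : 1 ∈ Fil 0)
    (hmul : ∀ i j x y, x ∈ Fil i → y ∈ Fil j → x * y ∈ Fil (i + j)) {α β : ℕ} {v u : σ → B}
    (hv : ∀ i, v i ∈ Fil α) (hu : ∀ i, u i ∈ Fil β) {f : MvPolynomial σ k} {d : ℕ}
    (hf : f.IsHomogeneous d) :
    (lineRestr f v u).natDegree ≤ d ∧
      ∀ i j, i + j = d → (lineRestr f v u).coeff j ∈ Fil (α * i + β * j) := by
  classical
  let Good : ℕ → Polynomial B → Prop := fun D p =>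
    p.natDegree ≤ D ∧ ∀ i j, i + j = D → p.coeff j ∈ Fil (α * i + β * j)
  have good_mul : ∀ D E p q, Good D p → Good E q → Good (D + E) (p * q) := by
    rintro D E p q ⟨hp, hp'⟩ ⟨hq, hq'⟩
    refine ⟨Polynomial.natDegree_mul_le.trans (add_le_add hp hq), ?_⟩
    intro i j hij
    rw [Polynomial.coeff_mul]
    refine Submodule.sum_mem _ ?_
    rintro ⟨a, b⟩ hab
    rw [Finset.HasAntidiagonal.mem_antidiagonal] at hab
    dsimp only at hab ⊢
    by_cases ha : a ≤ D
    · by_cases hb : b ≤ E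
      · obtain ⟨a', rfl⟩ := Nat.exists_eq_add_of_le ha
        obtain ⟨b', rfl⟩ := Nat.exists_eq_add_of_le hb
        have := hmul _ _ _ _ (hp' a' a (add_comm _ _)) (hq' b' b (add_comm _ _))
        have hi : i = a' + b' := by omega
        convert this using 2
        subst hi
        subst hab
        ring
      · simp [Polynomial.coeff_eq_zero_of_natDegree_lt (lt_of_le_of_lt hq (not_le.mp hb))]
    · simp [Polynomial.coeff_eq_zero_of_natDegree_lt (lt_of_le_of_lt hp (not_le.mp ha))]
  have good_one : Good 0 1 := by
    refine ⟨by simp, ?_⟩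
    intro i j hij
    obtain ⟨rfl, rfl⟩ : i = 0 ∧ j = 0 := by omega
    simpa using h1
  have good_lin : ∀ i, Good 1 (Polynomial.C (v i) + Polynomial.X * Polynomial.C (u i)) := by
    intro s
    constructor
    · compute_degree
    · intro i j hij
      obtain ⟨rfl, rfl⟩ | ⟨rfl, rfl⟩ : (i = 1 ∧ j = 0) ∨ (i = 0 ∧ j = 1) := by omega
      · simpa using hv s
      · simpa [Polynomial.coeff_X_mul, Polynomial.coeff_C_succ] using hu s
  have good_pow : ∀ i m, Good m
      ((Polynomial.C (v i) + Polynomial.X * Polynomial.C (u i)) ^ m) := by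
    intro i m
    induction m with
    | zero => simpa using good_one
    | succ m ih => rw [pow_succ]; exact good_mul _ _ _ _ ih (good_lin i)
  have good_prod : ∀ (S : Finset σ) (s : σ → ℕ), Good (∑ i ∈ S, s i)
      (∏ i ∈ S, (Polynomial.C (v i) + Polynomial.X * Polynomial.C (u i)) ^ s i) := by
    intro S s
    induction S using Finset.induction_on with
    | empty => simpa using good_one
    | insert a S ha ih =>
      rw [Finset.sum_insert ha, Finset.prod_insert ha]
      exact good_mul _ _ _ _ (good_pow a _) ih
  change Good d (lineRestr f v u)
  have hsum : lineRestr f v u = ∑ s ∈ f.support, algebraMap k (Polynomial B) (f.coeff s) *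
      ∏ i ∈ s.support, (Polynomial.C (v i) + Polynomial.X * Polynomial.C (u i)) ^ s i := by
    rw [lineRestr, aeval_def, eval₂_eq]
  have hterm : ∀ s ∈ f.support, Good d (algebraMap k (Polynomial B) (f.coeff s) *
      ∏ i ∈ s.support, (Polynomial.C (v i) + Polynomial.X * Polynomial.C (u i)) ^ s i) := by
    intro s hs
    have hd : ∑ i ∈ s.support, s i = d := by
      have := hf (mem_support_iff.mp hs)
      simpa [Finsupp.weight_apply, Finsupp.sum] using this
    obtain ⟨g1, g2⟩ := good_prod s.support s
    rw [hd] at g1 g2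
    rw [← Algebra.smul_def]
    exact ⟨(Polynomial.natDegree_smul_le _ _).trans g1, fun i j hij => by
      rw [Polynomial.coeff_smul]; exact Submodule.smul_mem _ _ (g2 i j hij)⟩
  rw [hsum]
  constructor
  · exact Polynomial.natDegree_sum_le_of_forall_le _ _ fun s hs => (hterm s hs).1
  · intro i j hij
    rw [Polynomial.finsetSum_coeff]
    exact Submodule.sum_mem _ fun s hs => (hterm s hs).2 i j hij

theorem natDegree_lineRestr_le {f : MvPolynomial σ k} {d : ℕ} (hf : f.IsHomogeneous d)
    (v u : σ → A) : (lineRestr f v u).natDegree ≤ d :=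
  (lineRestr_good (fun _ => (⊤ : Submodule k A)) trivial (fun _ _ _ _ _ _ => trivial)
    (α := 0) (β := 0) (fun _ => trivial) (fun _ => trivial) hf).1

/-- Degree and leading coefficient of a form evaluated at polynomials. -/
theorem aeval_polynomial_top {G : MvPolynomial σ k} {D m : ℕ} (hG : G.IsHomogeneous D)
    {w : σ → Polynomial k} (hw : ∀ j, (w j).natDegree ≤ m) :
    (aeval w G).natDegree ≤ m * D ∧
      (aeval w G).coeff (m * D) = eval (fun j => (w j).coeff m) G := by
  classical
  have hsum : aeval w G = ∑ s ∈ G.support, algebraMap k (Polynomial k) (G.coeff s) *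
      ∏ i ∈ s.support, w i ^ s i := by
    rw [aeval_def, eval₂_eq]
  have hprod : ∀ (S : Finset σ) (s : σ → ℕ),
      (∏ i ∈ S, w i ^ s i).natDegree ≤ m * ∑ i ∈ S, s i ∧
      (∏ i ∈ S, w i ^ s i).coeff (m * ∑ i ∈ S, s i) = ∏ i ∈ S, (w i).coeff m ^ s i := by
    intro S s
    induction S using Finset.induction_on with
    | empty => simp
    | insert a S ha ih =>
      rw [Finset.sum_insert ha, Finset.prod_insert ha, Finset.prod_insert ha, mul_add]
      have h1 : (w a ^ s a).natDegree ≤ m * s a := by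
        rw [mul_comm]; exact Polynomial.natDegree_pow_le_of_le _ (hw a)
      refine ⟨Polynomial.natDegree_mul_le.trans (add_le_add h1 ih.1), ?_⟩
      rw [Polynomial.coeff_mul_add_eq_of_natDegree_le h1 ih.1, ih.2, mul_comm m,
        Polynomial.coeff_pow_of_natDegree_le (hw a)]
  have hd : ∀ s ∈ G.support, ∑ i ∈ s.support, s i = D := by
    intro s hs
    have := hG (mem_support_iff.mp hs)
    simpa [Finsupp.weight_apply, Finsupp.sum] using this
  rw [hsum]
  constructor
  · refine Polynomial.natDegree_sum_le_of_forall_le _ _ fun s hs => ?_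
    rw [← Algebra.smul_def]
    have := (hprod s.support s).1
    rw [hd s hs] at this
    exact (Polynomial.natDegree_smul_le _ _).trans this
  · rw [Polynomial.finsetSum_coeff, eval_eq]
    refine Finset.sum_congr rfl fun s hs => ?_
    have := (hprod s.support s).2
    rw [hd s hs] at this
    rw [← Algebra.smul_def, Polynomial.coeff_smul, this, smul_eq_mul]

theorem coeff_natDegree_lineRestr {f : MvPolynomial σ k} {d : ℕ} (hf : f.IsHomogeneous d)
    (v u : σ → k) : (lineRestr f v u).coeff d = eval u f := by
  have h := (aeval_polynomial_top (m := 1) hf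
    (w := fun j => Polynomial.C (v j) + Polynomial.X * Polynomial.C (u j))
    (fun j => by compute_degree)).2
  rw [one_mul] at h
  rw [lineRestr, h]
  congr 2
  funext j
  simp [Polynomial.coeff_C_succ]

end Restriction

section Field

variable {k σ : Type*} [Field k]

theorem eval_smul_of_isHomogeneous {f : MvPolynomial σ k} {d : ℕ} (hf : f.IsHomogeneous d)
    (t : k) (v : σ → k) : eval (t • v) f = t ^ d * eval v f := by
  have h := lineRestr_smul f 0 v t d
  rwa [coeff_natDegree_lineRestr hf, coeff_natDegree_lineRestr hf] at h

theorem eval_lineRestr' (f : MvPolynomial σ k) (v u : σ → k) (t : k) :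
    (lineRestr f v u).eval t = eval (v + t • u) f := by
  rw [eval_lineRestr, MvPolynomial.aeval_eq_eval]

theorem coeff_one_lineRestr' [Fintype σ] (f : MvPolynomial σ k) (v u : σ → k) :
    (lineRestr f v u).coeff 1 = eval v (dirDeriv f u) := by
  rw [coeff_one_lineRestr]
  simp [dirDeriv, MvPolynomial.aeval_eq_eval]

theorem coeff_lineRestr_symm [Infinite k] {f : MvPolynomial σ k} {d : ℕ}
    (hf : f.IsHomogeneous d) (v u : σ → k) {i j : ℕ} (hij : i + j = d) :
    (lineRestr f v u).coeff i = (lineRestr f u v).coeff j := by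
  have h : (lineRestr f u v).reflect d = lineRestr f v u := by
    apply Polynomial.eq_of_infinite_eval_eq
    refine Set.Infinite.mono (s := {0}ᶜ) ?_ (Set.Finite.infinite_compl (Set.finite_singleton _))
    intro t ht
    have ht : t ≠ 0 := ht
    have : Invertible t⁻¹ := invertibleOfNonzero (inv_ne_zero ht)
    have h1 := Polynomial.eval₂_reflect_mul_pow (RingHom.id k) t⁻¹ d (lineRestr f u v)
      (natDegree_lineRestr_le hf _ _)
    rw [invOf_eq_inv, inv_inv] at h1
    simp only [Polynomial.eval₂_id] at h1
    rw [eval_lineRestr'] at h1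
    have h2 : v + t • u = t • (u + t⁻¹ • v) := by
      rw [smul_add, smul_smul, mul_inv_cancel₀ ht, one_smul, add_comm]
    change Polynomial.eval t _ = Polynomial.eval t _
    rw [eval_lineRestr', h2, eval_smul_of_isHomogeneous hf, ← h1, mul_left_comm,
      ← mul_pow, mul_inv_cancel₀ ht, one_pow, mul_one]
  rw [← h, Polynomial.coeff_reflect, Polynomial.revAt_le (by omega)]
  congr 1
  omega

theorem exists_form_zero [IsAlgClosed k] {g : MvPolynomial σ k} {m : ℕ} (hm : m ≠ 0)
    (hg : g.IsHomogeneous m) (u v : σ → k) :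
    ∃ s t : k, (s ≠ 0 ∨ t ≠ 0) ∧ eval (s • u + t • v) g = 0 := by
  by_cases hd : (lineRestr g u v).degree = 0
  · refine ⟨0, 1, Or.inr one_ne_zero, ?_⟩
    have := coeff_natDegree_lineRestr hg u v
    rw [Polynomial.eq_C_of_degree_eq_zero hd, Polynomial.coeff_C_of_ne_zero hm] at this
    simpa using this.symm
  · obtain ⟨t, ht⟩ := IsAlgClosed.exists_root _ hd
    refine ⟨1, t, Or.inl one_ne_zero, ?_⟩
    rw [Polynomial.IsRoot, eval_lineRestr'] at ht
    simpa using ht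

end Field

section Bezout

/-- Exponent vectors of total degree less than `M`. -/
def expBox (m M : ℕ) : Finset (Fin m → ℕ) :=
  (Fintype.piFinset fun _ => Finset.range M).filter fun b => ∑ i, b i < M

theorem mem_expBox {m M : ℕ} {b : Fin m → ℕ} : b ∈ expBox m M ↔ ∑ i, b i < M := by
  simp only [expBox, Finset.mem_filter, Fintype.mem_piFinset, Finset.mem_range,
    and_iff_right_iff_imp]
  intro h i
  exact lt_of_le_of_lt (Finset.single_le_sum (f := b) (fun _ _ => Nat.zero_le _)
    (Finset.mem_univ i)) h

theorem card_expBox_le (m M : ℕ) : (expBox m M).card ≤ M ^ m := by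
  refine (Finset.card_filter_le _ _).trans ?_
  simp

theorem one_le_card_expBox (m : ℕ) {M : ℕ} (hM : 0 < M) : 1 ≤ (expBox m M).card :=
  Finset.card_pos.mpr ⟨0, by simpa [mem_expBox] using hM⟩

theorem card_expBox_mono {m M M' : ℕ} (h : M ≤ M') : (expBox m M).card ≤ (expBox m M').card :=
  Finset.card_le_card fun b hb => by rw [mem_expBox] at *; omega

theorem card_expBox_mul_le (m n M : ℕ) (hn : 0 < n) :
    (expBox m (n * M)).card ≤ n ^ m * (expBox m M).card := by
  have : n ^ m * (expBox m M).card =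
      ((Fintype.piFinset fun _ : Fin m => Finset.range n) ×ˢ expBox m M).card := by
    simp
  rw [this]
  refine Finset.card_le_card_of_injOn (fun b => (fun i => b i % n, fun i => b i / n)) ?_ ?_
  · intro b hb
    rw [Finset.mem_coe, mem_expBox] at hb
    simp only [Finset.coe_product, Set.mem_prod, Finset.mem_coe, Fintype.mem_piFinset,
      Finset.mem_range, mem_expBox]
    refine ⟨fun i => Nat.mod_lt _ hn, ?_⟩
    have h2 : n * ∑ i, b i / n ≤ ∑ i, b i := by
      rw [Finset.mul_sum]
      exact Finset.sum_le_sum fun i _ => Nat.mul_div_le _ _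
    exact lt_of_mul_lt_mul_left (lt_of_le_of_lt h2 hb) (Nat.zero_le _)
  · intro b _ b' _ h
    simp only [Prod.mk.injEq] at h
    funext i
    rw [← Nat.div_add_mod (b i) n, ← Nat.div_add_mod (b' i) n, congrFun h.1 i, congrFun h.2 i]

/-- A growth argument: a polynomially bounded function cannot satisfy a geometric recursion. -/
theorem le_of_growth {a N c m : ℕ} (S : ℕ → ℕ) (h1 : 1 ≤ S 1) (hS : ∀ M, S M ≤ M ^ m)
    (h : ∀ M, 0 < M → a * S M ≤ N * S (M + c)) : a ≤ N := by
  by_contra! hlt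
  have key : ∀ j, (N + 1) ^ j ≤ N ^ j * S (1 + j * c) := by
    intro j
    induction j with
    | zero => simpa using h1
    | succ j ih =>
      calc (N + 1) ^ (j + 1) = (N + 1) * (N + 1) ^ j := by ring
        _ ≤ a * (N ^ j * S (1 + j * c)) := Nat.mul_le_mul hlt ih
        _ = N ^ j * (a * S (1 + j * c)) := by ring
        _ ≤ N ^ j * (N * S (1 + j * c + c)) := Nat.mul_le_mul_left _ (h _ (by omega))
        _ = N ^ (j + 1) * S (1 + (j + 1) * c) := by ring_nf
  set r : ℝ := N / (N + 1) with hr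
  have hN : (0 : ℝ) < N + 1 := by positivity
  have hr1 : |r| < 1 := by
    rw [abs_of_nonneg (by positivity), hr, div_lt_one hN]
    linarith
  have hlim := (tendsto_pow_const_mul_const_pow_of_abs_lt_one m hr1).const_mul ((1 + c : ℝ) ^ m)
  rw [mul_zero] at hlim
  have hge : ∀ᶠ j : ℕ in Filter.atTop, (1 : ℝ) ≤ (1 + c : ℝ) ^ m * ((j : ℝ) ^ m * r ^ j) := by
    filter_upwards [Filter.eventually_ge_atTop 1] with j hj
    have h2 : (N + 1) ^ j ≤ N ^ j * ((1 + c) * j) ^ m := by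
      refine (key j).trans (Nat.mul_le_mul_left _ ((hS _).trans (Nat.pow_le_pow_left ?_ _)))
      nlinarith
    have h3 : ((N : ℝ) + 1) ^ j ≤ N ^ j * ((1 + c) * j) ^ m := by exact_mod_cast h2
    rw [← mul_assoc, ← mul_pow, hr, div_pow, ← mul_div_assoc, le_div_iff₀ (by positivity)]
    linarith
  have := ge_of_tendsto hlim hge
  linarith

variable {k : Type*} [Field k]

theorem exists_separating {m : ℕ} (V : Finset (Fin m → k)) (v : Fin m → k) :
    ∃ q : MvPolynomial (Fin m) k, eval v q = 1 ∧ ∀ v' ∈ V, v' ≠ v → eval v' q = 0 := by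
  classical
  have : ∀ v' : Fin m → k, ∃ q : MvPolynomial (Fin m) k, eval v q = 1 ∧
      (v' ≠ v → eval v' q = 0) := by
    intro v'
    by_cases h : v' = v
    · exact ⟨1, by simp, fun h' => absurd h h'⟩
    · obtain ⟨i, hi⟩ := Function.ne_iff.mp h
      refine ⟨C (v i - v' i)⁻¹ * (X i - C (v' i)), ?_, fun _ => by simp⟩
      simp [inv_mul_cancel₀ (sub_ne_zero.mpr (Ne.symm hi))]
  choose q h1 h2 using this
  refine ⟨∏ v' ∈ V, q v', by simp [map_prod, h1], fun v' hv' hne => ?_⟩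
  rw [map_prod]
  exact Finset.prod_eq_zero hv' (h2 v' hne)

theorem card_le_of_jacobian_square [Infinite k] {m n : ℕ} (hn : 0 < n)
    (V : Finset (Fin m → k)) (h : Fin m → MvPolynomial (Fin m) k)
    (hdeg : ∀ i, (h i).totalDegree ≤ n) (hzero : ∀ v ∈ V, ∀ i, eval v (h i) = 0)
    (hJ : ∀ v ∈ V, ∀ y, (∀ i, eval v (dirDeriv (h i) y) = 0) → y = 0) : V.card ≤ n ^ m := by
  classical
  choose q hq1 hq0 using exists_separating V
  let c := V.sup fun v => (q v).totalDegree
  let P : ∀ M, (expBox m M × V → k) →ₗ[k] MvPolynomial (Fin m) k := fun M =>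
    ∑ x : expBox m M × V, (LinearMap.toSpanSingleton k (MvPolynomial (Fin m) k)
      ((∏ i, h i ^ (x.1.1 i)) * q x.2.1)).comp (LinearMap.proj x)
  have hP : ∀ M a, P M a = ∑ x : expBox m M × V, a x • ((∏ i, h i ^ (x.1.1 i)) * q x.2.1) := by
    intro M a
    simp [P]
  have hPinj : ∀ M a, P M a = 0 → a = 0 := by
    intro M a ha
    have key : ∀ j, ∀ x : expBox m M × V, ∑ i, x.1.1 i = j → a x = 0 := by
      intro j
      induction j using Nat.strong_induction_on with
      | _ j ih =>
      rintro ⟨b0, v0⟩ hb0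
      have hz : ∀ z : Fin m → k, ∑ b : expBox m M,
          (if ∑ i, b.1 i = j then a (b, v0) * ∏ i, z i ^ b.1 i else 0) = 0 := by
        intro z
        let L : (Fin m → k) →ₗ[k] (Fin m → k) :=
          { toFun := fun y i => eval v0.1 (dirDeriv (h i) y)
            map_add' := fun y y' => by funext i; exact eval_dirDeriv_add _ _ _ _
            map_smul' := fun s y => by funext i; exact eval_dirDeriv_smul _ _ _ _ }
        have hL : Function.Injective L := by
          rw [← LinearMap.ker_eq_bot, LinearMap.ker_eq_bot']
          intro y hy
          exact hJ _ v0.2 y fun i => congrFun hy i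
        obtain ⟨y, rfl⟩ := LinearMap.injective_iff_surjective.mp hL z
        have hg : ∀ i, ∃ g : Polynomial k, lineRestr (h i) v0.1 y = Polynomial.X * g ∧
            g.coeff 0 = L y i := by
          intro i
          have h0 : (lineRestr (h i) v0.1 y).coeff 0 = 0 := by
            rw [coeff_zero_lineRestr, aeval_eq_eval]
            exact hzero _ v0.2 i
          obtain ⟨g, hg⟩ := Polynomial.X_dvd_iff.mpr h0
          refine ⟨g, hg, ?_⟩
          rw [← Polynomial.coeff_X_mul g 0, ← hg, coeff_one_lineRestr']
          rfl
        choose g hg hg0 using hg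
        have h1 : (lineRestr (P M a) v0.1 y).coeff j = 0 := by
          rw [ha]; simp [lineRestr]
        rw [hP] at h1
        simp only [lineRestr, map_sum, map_smul, map_mul, map_prod, map_pow] at h1
        change (∑ x : expBox m M × V, a x • ((∏ i, (lineRestr (h i) v0.1 y) ^ (x.1.1 i)) *
          lineRestr (q x.2.1) v0.1 y)).coeff j = 0 at h1
        rw [Polynomial.finsetSum_coeff, Fintype.sum_prod_type] at h1
        refine Eq.trans (Finset.sum_congr rfl fun b _ => ?_) h1
        have hprod : ∀ v : V, ((∏ i, (lineRestr (h i) v0.1 y) ^ (b.1 i)) *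
            lineRestr (q v.1) v0.1 y) = Polynomial.X ^ (∑ i, b.1 i) *
              ((∏ i, g i ^ b.1 i) * lineRestr (q v.1) v0.1 y) := by
          intro v
          simp only [hg, mul_pow, Finset.prod_mul_distrib, Finset.prod_pow_eq_pow_sum]
          ring
        simp only [hprod, Polynomial.coeff_smul, Polynomial.coeff_X_pow_mul']
        split_ifs with hbj hle hle
        · subst hbj
          have hpow : ∀ i, (g i ^ b.1 i).coeff 0 = L y i ^ b.1 i := by
            intro i
            rw [Polynomial.coeff_zero_eq_eval_zero, Polynomial.eval_pow,
              ← Polynomial.coeff_zero_eq_eval_zero, hg0]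
          simp only [Nat.sub_self, Polynomial.mul_coeff_zero, Polynomial.coeff_zero_prod,
            hpow, coeff_zero_lineRestr, aeval_eq_eval]
          rw [Finset.sum_eq_single v0]
          · change _ = a (b, v0) * (_ * eval v0.1 (q v0.1))
            rw [hq1, mul_one]
          · intro v _ hv
            change a (b, v) * (_ * eval v0.1 (q v.1)) = 0
            rw [hq0 _ _ v0.2 (fun h => hv (Subtype.ext h.symm))]
            simp
          · simp
        · exact absurd hbj.le hle
        · symm
          refine Finset.sum_eq_zero fun v _ => ?_
          rw [ih _ (lt_of_le_of_ne hle hbj) (b, v) rfl, zero_smul]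
        · simp
      have hpoly : (∑ b : expBox m M, if ∑ i, b.1 i = j then
          monomial (Finsupp.equivFunOnFinite.symm b.1) (a (b, v0)) else 0) = 0 := by
        apply MvPolynomial.funext
        intro z
        rw [map_zero, ← hz z, map_sum]
        refine Finset.sum_congr rfl fun b _ => ?_
        split_ifs
        · rw [eval_monomial, Finsupp.prod_fintype _ _ (by simp)]
          simp
        · simp
      have hc := congrArg (coeff (Finsupp.equivFunOnFinite.symm b0.1)) hpoly
      rw [coeff_sum, Finset.sum_eq_single b0] at hc
      · simpa [hb0] using hc
      · intro b _ hb
        split_ifs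
        · rw [coeff_monomial, if_neg]
          intro h
          exact hb (Subtype.ext (Finsupp.equivFunOnFinite.symm.injective h))
        · simp
      · simp
    funext x
    exact key _ x rfl
  have hPdeg : ∀ M a, 0 < M → (P M a).totalDegree < n * M + c := by
    intro M a hM
    have hle : (P M a).totalDegree ≤ n * (M - 1) + c := by
      rw [hP]
      refine totalDegree_finsetSum_le fun x _ => (totalDegree_smul_le _ _).trans ?_
      refine (totalDegree_mul _ _).trans (add_le_add ?_ ?_)
      · refine (totalDegree_finsetProd _ _).trans ?_
        have hx := mem_expBox.mp x.1.2
        calc ∑ i, (h i ^ x.1.1 i).totalDegree ≤ ∑ i, x.1.1 i * n :=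
              Finset.sum_le_sum fun i _ =>
                (totalDegree_pow _ _).trans (Nat.mul_le_mul_left _ (hdeg i))
          _ = n * ∑ i, x.1.1 i := by rw [← Finset.sum_mul, mul_comm]
          _ ≤ n * (M - 1) := Nat.mul_le_mul_left _ (by omega)
      · exact Finset.le_sup (f := fun v => (q v).totalDegree) x.2.2
    have : n * (M - 1) < n * M := Nat.mul_lt_mul_of_pos_left (by omega) hn
    omega
  have hdim : ∀ M, 0 < M → V.card * (expBox m M).card ≤ (expBox m (n * M + c)).card := by
    intro M hM
    let T : (expBox m M × V → k) →ₗ[k] (expBox m (n * M + c) → k) :=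
      LinearMap.pi fun b => (lcoeff k (Finsupp.equivFunOnFinite.symm b.1)).comp (P M)
    have hT : Function.Injective T := by
      rw [← LinearMap.ker_eq_bot, LinearMap.ker_eq_bot']
      intro a ha
      apply hPinj M
      ext s
      rw [coeff_zero]
      by_cases hs : s ∈ (P M a).support
      · have hlt := lt_of_le_of_lt (le_totalDegree hs) (hPdeg M a hM)
        have hmem : (⇑s) ∈ expBox m (n * M + c) := by
          rw [mem_expBox]
          rwa [Finsupp.sum_fintype _ _ (by simp)] at hlt
        have := congrFun ha ⟨_, hmem⟩
        simpa [T] using this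
      · simpa using hs
    have := LinearMap.finrank_le_finrank_of_injective hT
    simp only [Module.finrank_fintype_fun_eq_card, Fintype.card_prod, Fintype.card_coe] at this
    rwa [mul_comm]
  refine le_of_growth (c := c) (fun M => (expBox m M).card) (one_le_card_expBox m one_pos)
    (card_expBox_le m) fun M hM => ?_
  refine (hdim M hM).trans (le_trans (card_expBox_mono ?_) (card_expBox_mul_le m n (M + c) hn))
  nlinarith

theorem card_le_of_jacobian [Infinite k] {m n : ℕ} {ι : Type*} [Fintype ι] (hn : 0 < n)
    (V : Finset (Fin m → k)) (g : ι → MvPolynomial (Fin m) k)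
    (hdeg : ∀ i, (g i).totalDegree ≤ n) (hzero : ∀ v ∈ V, ∀ i, eval v (g i) = 0)
    (hJ : ∀ v ∈ V, ∀ y, (∀ i, eval v (dirDeriv (g i) y) = 0) → y = 0) : V.card ≤ n ^ m := by
  classical
  let J : (Fin m → k) → Matrix ι (Fin m) k := fun v i j => eval v (pderiv j (g i))
  have hJy : ∀ v y i, (J v).mulVec y i = eval v (dirDeriv (g i) y) := by
    intro v y i
    simp [J, Matrix.mulVec, dotProduct, dirDeriv, mul_comm]
  let JC : (Fin m → k) → Matrix ι (Fin m) (MvPolynomial (Fin m × ι) k) :=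
    fun v i j => C (J v i j)
  let G : (Fin m → k) → MvPolynomial (Fin m × ι) k := fun v =>
    Matrix.det (Matrix.mvPolynomialX (Fin m) ι k * JC v)
  have hGeval : ∀ v (Λ : Fin m → ι → k),
      eval (fun p : Fin m × ι => Λ p.1 p.2) (G v) = (Matrix.of Λ * J v).det := by
    intro v Λ
    simp only [G]
    rw [RingHom.map_det]
    congr 1
    ext i j
    rw [RingHom.mapMatrix_apply, Matrix.map_apply, Matrix.mul_apply, Matrix.mul_apply]
    simp [JC]
  have hG : ∀ v ∈ V, G v ≠ 0 := by
    intro v hv h0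
    have hinj : LinearMap.ker (J v).mulVecLin = ⊥ := by
      rw [LinearMap.ker_eq_bot']
      intro y hy
      refine hJ v hv y fun i => ?_
      rw [← hJy]
      exact congrFun hy i
    obtain ⟨R, hR⟩ := LinearMap.exists_leftInverse_of_injective _ hinj
    have h1 : LinearMap.toMatrix' R * J v = 1 := by
      have h2 := LinearMap.toMatrix'_comp R (J v).mulVecLin
      rwa [hR, LinearMap.toMatrix'_id, ← Matrix.toLin'_apply', LinearMap.toMatrix'_toLin',
        eq_comm] at h2
    have h3 := hGeval v fun i j => LinearMap.toMatrix' R i j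
    rw [h0, map_zero] at h3
    have h4 : (LinearMap.toMatrix' R * J v).det = 0 := h3.symm
    rw [h1, Matrix.det_one] at h4
    exact one_ne_zero h4
  have hprod : (∏ v ∈ V, G v) ≠ 0 := Finset.prod_ne_zero_iff.mpr hG
  obtain ⟨x, hx⟩ : ∃ x, eval x (∏ v ∈ V, G v) ≠ 0 := by
    by_contra! hcon
    exact hprod (MvPolynomial.funext fun x => by simp [hcon])
  rw [map_prod, Finset.prod_ne_zero_iff] at hx
  let Λ : Matrix (Fin m) ι k := fun i j => x (i, j)
  refine card_le_of_jacobian_square hn V (fun i => ∑ j, Λ i j • g j) ?_ ?_ ?_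
  · intro i
    refine totalDegree_finsetSum_le fun j _ => (totalDegree_smul_le _ _).trans (hdeg j)
  · intro v hv i
    simp [hzero v hv]
  · intro v hv y hy
    have hdet : (Λ * J v).det ≠ 0 := by
      have h1 : (Λ * J v).det = eval x (G v) := (hGeval v fun i j => x (i, j)).symm
      rw [h1]
      exact hx v hv
    apply Matrix.eq_zero_of_mulVec_eq_zero hdet
    funext i
    have h2 : ∀ i, ((Λ * J v).mulVec y) i = eval v (dirDeriv (∑ j, Λ i j • g j) y) := by
      intro i
      rw [← Matrix.mulVec_mulVec]
      simp only [Matrix.mulVec, dotProduct] at hJy ⊢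
      simp only [hJy]
      simp only [dirDeriv, map_sum, Finset.mul_sum, map_mul, eval_C, Derivation.map_smul,
        smul_eval]
      rw [Finset.sum_comm]
      refine Finset.sum_congr rfl fun j _ => Finset.sum_congr rfl fun l _ => ?_
      ring
    rw [h2, hy]
    rfl

end Bezout

section Lines

variable {k : Type*} [Field k]

/-- The differential of `f` at `v`. -/
noncomputable def grad {σ : Type*} [Fintype σ] (f : MvPolynomial σ k) (v : σ → k) :
    (σ → k) →ₗ[k] k where
  toFun u := eval v (dirDeriv f u)
  map_add' := eval_dirDeriv_add f v
  map_smul' s u := eval_dirDeriv_smul f v u s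

theorem grad_apply {σ : Type*} [Fintype σ] (f : MvPolynomial σ k) (v u : σ → k) :
    grad f v u = eval v (dirDeriv f u) := rfl

theorem coeff_one_lineRestr_grad {σ : Type*} [Fintype σ] (f : MvPolynomial σ k) (v u : σ → k) :
    (lineRestr f v u).coeff 1 = grad f v u :=
  coeff_one_lineRestr' f v u

theorem eval_lineRestr_dirDeriv {σ : Type*} [Fintype σ] (f : MvPolynomial σ k)
    (e v u : σ → k) (t : k) : (lineRestr (dirDeriv f e) v u).eval t = grad f (v + t • u) e :=
  eval_lineRestr' _ _ _ _

theorem IsSmoothSurface.grad_ne_zero {f : MvPolynomial (Fin 4) k} {d : ℕ}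
    (hf : IsSmoothSurface f d) {v : Fin 4 → k} (hv : v ≠ 0) (h0 : eval v f = 0) :
    grad f v ≠ 0 := by
  intro hg
  refine hf.2.2 v hv ⟨h0, fun i => ?_⟩
  have := LinearMap.congr_fun hg (Pi.single i 1)
  rw [grad_apply, dirDeriv, map_sum, Finset.sum_eq_single i] at this
  · simpa using this
  · intro j _ hj
    simp [Pi.single_eq_of_ne hj]
  · simp

theorem finrank_ker_grad {f : MvPolynomial (Fin 4) k} {d : ℕ}
    (hf : IsSmoothSurface f d) {v : Fin 4 → k} (hv : v ≠ 0) (h0 : eval v f = 0) :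
    Module.finrank k (LinearMap.ker (grad f v)) = 3 := by
  have h1 := LinearMap.finrank_range_add_finrank_ker (grad f v)
  have h2 : LinearMap.range (grad f v) = ⊤ :=
    LinearMap.range_eq_top.mpr (LinearMap.surjective (hf.grad_ne_zero hv h0))
  rw [h2] at h1
  simp at h1
  omega

theorem lineRestr_eq_zero [Infinite k] {σ : Type*} {f : MvPolynomial σ k}
    {W : Submodule k (σ → k)} (hW : ∀ v ∈ W, eval v f = 0) {v u : σ → k} (hv : v ∈ W)
    (hu : u ∈ W) : lineRestr f v u = 0 := by
  apply Polynomial.funext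
  intro t
  rw [eval_lineRestr', Polynomial.eval_zero]
  exact hW _ (W.add_mem hv (W.smul_mem t hu))

theorem grad_eq_zero_of_mem [Infinite k] {σ : Type*} [Fintype σ] {f : MvPolynomial σ k}
    {W : Submodule k (σ → k)} (hW : ∀ v ∈ W, eval v f = 0) {v u : σ → k} (hv : v ∈ W)
    (hu : u ∈ W) : grad f v u = 0 := by
  rw [← coeff_one_lineRestr_grad, lineRestr_eq_zero hW hv hu, Polynomial.coeff_zero]

theorem IsLineOn.le_ker [Infinite k] {f : MvPolynomial (Fin 4) k}
    {W : Submodule k (Fin 4 → k)} (hW : IsLineOn f W) {v : Fin 4 → k} (hv : v ∈ W) :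
    W ≤ LinearMap.ker (grad f v) :=
  fun _ hu => grad_eq_zero_of_mem hW.2 hv hu

/-- The differential cannot vanish on two subspaces spanning everything. -/
theorem not_grad_zero_of_sup {f : MvPolynomial (Fin 4) k} {d : ℕ} (hf : IsSmoothSurface f d)
    {v : Fin 4 → k} (hv : v ≠ 0) (h0 : eval v f = 0) {U W : Submodule k (Fin 4 → k)}
    (hUW : U ⊔ W = ⊤) (hU : ∀ u ∈ U, grad f v u = 0) (hW : ∀ u ∈ W, grad f v u = 0) : False := by
  apply hf.grad_ne_zero hv h0
  have h1 : U ⊔ W ≤ LinearMap.ker (grad f v) := sup_le hU hW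
  rw [hUW, top_le_iff] at h1
  exact LinearMap.ker_eq_top.mp h1

theorem exists_basis_pair {V : Type*} [AddCommGroup V] [Module k V] {W : Submodule k V}
    (hW : Module.finrank k W = 2) : ∃ x y : V, W = Submodule.span k {x, y} ∧
      LinearIndependent k ![x, y] := by
  have : FiniteDimensional k W := Module.finite_of_finrank_pos (by omega)
  let b := Module.finBasisOfFinrankEq k W hW
  have hli : LinearIndependent k ![(b 0 : V), (b 1 : V)] := by
    have h := b.linearIndependent.map' W.subtype W.ker_subtype
    have h2 : W.subtype ∘ b = ![(b 0 : V), (b 1 : V)] := by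
      funext i
      fin_cases i <;> rfl
    rwa [h2] at h
  refine ⟨b 0, b 1, ?_, hli⟩
  symm
  apply Submodule.eq_of_le_of_finrank_le
  · rw [Submodule.span_le]
    rintro _ (rfl | rfl)
    · exact (b 0).2
    · exact (b 1).2
  · have h := finrank_span_eq_card hli
    rw [Matrix.range_cons, Matrix.range_cons, Matrix.range_empty, Set.union_empty] at h
    rw [hW]
    exact h.ge

theorem exists_mem_form_zero [IsAlgClosed k] {σ : Type*} {g : MvPolynomial σ k} {m : ℕ}
    (hm : m ≠ 0) (hg : g.IsHomogeneous m) {W : Submodule k (σ → k)}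
    (hW : 1 < Module.finrank k W) : ∃ v ∈ W, v ≠ 0 ∧ eval v g = 0 := by
  have : Nontrivial W := Module.nontrivial_of_finrank_pos (R := k) (by omega)
  obtain ⟨x, hx⟩ := exists_ne (0 : W)
  obtain ⟨y, hli⟩ := exists_linearIndependent_pair_of_one_lt_finrank hW hx
  obtain ⟨s, t, hst, h0⟩ := exists_form_zero hm hg x.1 y.1
  refine ⟨s • x + t • y, W.add_mem (W.smul_mem _ x.2) (W.smul_mem _ y.2), ?_, h0⟩
  intro h
  obtain ⟨h1, h2⟩ := LinearIndependent.pair_iff.mp hli s t (Subtype.ext h)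
  tauto

theorem finrank_sup_span {V : Type*} [AddCommGroup V] [Module k V] [FiniteDimensional k V]
    {W : Submodule k V} {u : V} (hu : u ∉ W) :
    Module.finrank k (W ⊔ Submodule.span k {u} : Submodule k V) = Module.finrank k W + 1 := by
  have h := Submodule.finrank_sup_add_finrank_inf_eq W (Submodule.span k {u})
  have hu0 : u ≠ 0 := by rintro rfl; exact hu W.zero_mem
  have hinf : W ⊓ Submodule.span k {u} = ⊥ := by
    rw [eq_bot_iff]
    rintro x ⟨hx, hx'⟩
    obtain ⟨c, rfl⟩ := Submodule.mem_span_singleton.mp hx'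
    by_cases hc : c = 0
    · simp [hc]
    · exact absurd ((W.smul_mem_iff hc).mp hx) hu
  rw [hinf, finrank_bot, finrank_span_singleton hu0] at h
  omega

theorem exists_mem_not_mem_finset [Infinite k] {V : Type*} [AddCommGroup V] [Module k V]
    (Q : Submodule k V) (T : Finset (Submodule k V)) (hT : ∀ p ∈ T, ¬ Q ≤ p) :
    ∃ v ∈ Q, ∀ p ∈ T, v ∉ p := by
  classical
  have h := Subspace.biUnion_ne_univ_of_top_notMem (k := k) (E := Q)
    (s := T.image (Submodule.comap Q.subtype)) (by
      simp only [Finset.mem_image, not_exists, not_and]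
      intro p hp h
      exact hT p hp (Submodule.comap_subtype_eq_top.mp h))
  rw [Set.ne_univ_iff_exists_notMem] at h
  obtain ⟨v, hv⟩ := h
  refine ⟨v.1, v.2, fun p hp hvp => hv ?_⟩
  simp only [Finset.mem_image, Set.iUnion_exists, Set.mem_iUnion]
  exact ⟨_, p, ⟨hp, rfl⟩, hvp⟩

theorem finrank_inf_le_one {ℓ m : Submodule k (Fin 4 → k)} (hℓ : Module.finrank k ℓ = 2)
    (hm : Module.finrank k m = 2) (hne : ℓ ≠ m) :
    Module.finrank k (ℓ ⊓ m : Submodule k (Fin 4 → k)) ≤ 1 := by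
  by_contra! h
  have h1 : ℓ ⊓ m = ℓ := Submodule.eq_of_le_of_finrank_le inf_le_left (by omega)
  have h2 : ℓ ⊓ m = m := Submodule.eq_of_le_of_finrank_le inf_le_right (by omega)
  exact hne (h1.symm.trans h2)

/-- Two distinct lines meeting a point span a plane. -/
theorem finrank_sup_eq_three {ℓ m : Submodule k (Fin 4 → k)} (hℓ : Module.finrank k ℓ = 2)
    (hm : Module.finrank k m = 2) (hne : ℓ ≠ m) (hmeet : ℓ ⊓ m ≠ ⊥) :
    Module.finrank k (ℓ ⊔ m : Submodule k (Fin 4 → k)) = 3 := by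
  have h1 := Submodule.finrank_sup_add_finrank_inf_eq ℓ m
  have h2 := finrank_inf_le_one hℓ hm hne
  have h3 : Module.finrank k (ℓ ⊓ m : Submodule k (Fin 4 → k)) ≠ 0 := fun h =>
    hmeet (Submodule.finrank_eq_zero.mp h)
  omega

theorem inf_ne_bot_of_le_plane {ℓ m Q : Submodule k (Fin 4 → k)} (hℓ : Module.finrank k ℓ = 2)
    (hm : Module.finrank k m = 2) (hQ : Module.finrank k Q = 3) (hℓQ : ℓ ≤ Q) (hmQ : m ≤ Q) :
    ℓ ⊓ m ≠ ⊥ := by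
  intro h
  have h1 := Submodule.finrank_sup_add_finrank_inf_eq ℓ m
  have h2 := Submodule.finrank_mono (sup_le hℓQ hmQ)
  rw [h, finrank_bot] at h1
  omega

theorem sup_eq_top_of_skew {ℓ m : Submodule k (Fin 4 → k)} (hℓ : Module.finrank k ℓ = 2)
    (hm : Module.finrank k m = 2) (h : ℓ ⊓ m = ⊥) : ℓ ⊔ m = ⊤ := by
  apply Submodule.eq_top_of_finrank_eq
  have h1 := Submodule.finrank_sup_add_finrank_inf_eq ℓ m
  rw [h, finrank_bot] at h1
  simp
  omega

theorem eq_of_common_pair {ℓ m : Submodule k (Fin 4 → k)} (hℓ : Module.finrank k ℓ = 2)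
    (hm : Module.finrank k m = 2) {x y : Fin 4 → k} (hxy : LinearIndependent k ![x, y])
    (hx : x ∈ ℓ) (hy : y ∈ ℓ) (hx' : x ∈ m) (hy' : y ∈ m) : ℓ = m := by
  by_contra hne
  have h := finrank_inf_le_one hℓ hm hne
  have h2 := finrank_span_eq_card hxy
  have h3 : Submodule.span k (Set.range ![x, y]) ≤ ℓ ⊓ m := by
    rw [Submodule.span_le]
    rintro _ ⟨i, rfl⟩
    fin_cases i
    · exact ⟨hx, hx'⟩
    · exact ⟨hy, hy'⟩
  have h4 := Submodule.finrank_mono h3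
  rw [h2] at h4
  simp at h4
  omega

variable [IsAlgClosed k] {f : MvPolynomial (Fin 4) k} {n : ℕ}

theorem exists_mem_plane_ne_zero (hf : IsSmoothSurface f (n + 1)) (hn : n ≠ 0)
    {Q : Submodule k (Fin 4 → k)} (hQ : Module.finrank k Q = 3) : ∃ u ∈ Q, eval u f ≠ 0 := by
  by_contra! hcon
  obtain ⟨e, he⟩ : ∃ e, e ∉ Q := by
    by_contra! h
    rw [(Submodule.eq_top_iff'.mpr h : Q = ⊤)] at hQ
    simp at hQ
  obtain ⟨v, hvW, hv0, hv⟩ := exists_mem_form_zero hn (isHomogeneous_dirDeriv hf.2.1 e)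
    (W := Q) (by omega)
  refine not_grad_zero_of_sup hf hv0 (hcon v hvW) (U := Q) (W := Submodule.span k {e})
    ?_ (fun u hu => grad_eq_zero_of_mem hcon hvW hu) ?_
  · apply Submodule.eq_top_of_finrank_eq
    rw [finrank_sup_span he, hQ]
    simp
  · intro u hu
    obtain ⟨c, rfl⟩ := Submodule.mem_span_singleton.mp hu
    rw [map_smul, grad_apply, hv, smul_zero]

theorem card_lines_in_plane_le (hf : IsSmoothSurface f (n + 1)) (hn : n ≠ 0)
    {Q : Submodule k (Fin 4 → k)} (hQ : Module.finrank k Q = 3)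
    (F : Finset (Submodule k (Fin 4 → k))) (hF : ∀ m ∈ F, IsLineOn f m ∧ m ≤ Q) :
    F.card ≤ n + 1 := by
  classical
  obtain ⟨u, huQ, hu⟩ := exists_mem_plane_ne_zero hf hn hQ
  obtain ⟨v, hvQ, hv⟩ := exists_mem_not_mem_finset Q
    (F.offDiag.image fun x => (x.1 ⊓ x.2) ⊔ Submodule.span k {u}) (by
      simp only [Finset.mem_image, Finset.mem_offDiag, Prod.exists]
      rintro p ⟨m, m', ⟨hm, hm', hne⟩, rfl⟩ hle
      have h1 := Submodule.finrank_mono hle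
      have h2 := finrank_inf_le_one (hF m hm).1.1 (hF m' hm').1.1 hne
      have h3 := Submodule.finrank_add_le_finrank_add_finrank (m ⊓ m') (Submodule.span k {u})
      have h4 : Module.finrank k (Submodule.span k {u}) ≤ 1 := by
        simpa using finrank_span_le_card (R := k) ({u} : Set (Fin 4 → k))
      omega)
  have hT : ∀ m ∈ F, ∃ t : k, v + t • u ∈ m := by
    intro m hm
    have hum : u ∉ m := fun h => hu ((hF m hm).1.2 u h)
    have hsup : m ⊔ Submodule.span k {u} = Q := by
      apply Submodule.eq_of_le_of_finrank_le
      · exact sup_le (hF m hm).2 (by simpa using huQ)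
      · rw [finrank_sup_span hum, hQ, (hF m hm).1.1]
    rw [← hsup] at hvQ
    obtain ⟨x, hx, y, hy, hxy⟩ := Submodule.mem_sup.mp hvQ
    obtain ⟨c, rfl⟩ := Submodule.mem_span_singleton.mp hy
    refine ⟨-c, ?_⟩
    rw [← hxy]
    simpa using hx
  choose! T hT using hT
  have hne : lineRestr f v u ≠ 0 := by
    intro h
    have := coeff_natDegree_lineRestr hf.2.1 v u
    rw [h, Polynomial.coeff_zero] at this
    exact hu this.symm
  have hroots : (lineRestr f v u).roots.toFinset.card ≤ n + 1 :=
    (Multiset.toFinset_card_le _).trans ((Polynomial.card_roots' _).trans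
      (natDegree_lineRestr_le hf.2.1 _ _))
  refine le_trans (Finset.card_le_card_of_injOn T ?_ ?_) hroots
  · intro m hm
    rw [Finset.mem_coe, Multiset.mem_toFinset, Polynomial.mem_roots hne, Polynomial.IsRoot,
      eval_lineRestr']
    exact (hF m hm).1.2 _ (hT m hm)
  · intro m hm m' hm' h
    by_contra hmm
    refine hv _ (Finset.mem_image_of_mem _
      (Finset.mem_offDiag.mpr (show (m, m').1 ∈ F ∧ (m, m').2 ∈ F ∧ _ from ⟨hm, hm', hmm⟩))) ?_
    refine Submodule.mem_sup.mpr ⟨v + T m • u, ⟨hT m hm, ?_⟩, -(T m) • u,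
      Submodule.smul_mem _ _ (Submodule.mem_span_singleton_self u), by simp⟩
    rw [h]
    exact hT m' hm'

theorem le_plane_of_triangle (hf : IsSmoothSurface f (n + 1))
    {ℓ m r : Submodule k (Fin 4 → k)} (hℓ : IsLineOn f ℓ) (hm : IsLineOn f m)
    (hr : IsLineOn f r) (hne : ℓ ≠ m) (hℓm : ℓ ⊓ m ≠ ⊥) (hrℓ : r ⊓ ℓ ≠ ⊥)
    (hrm : r ⊓ m ≠ ⊥) : r ≤ ℓ ⊔ m := by
  obtain ⟨y, ⟨hyr, hyℓ⟩, hy0⟩ := Submodule.exists_mem_ne_zero_of_ne_bot hrℓ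
  obtain ⟨z, ⟨hzr, hzm⟩, hz0⟩ := Submodule.exists_mem_ne_zero_of_ne_bot hrm
  have h3 := finrank_sup_eq_three hℓ.1 hm.1 hne hℓm
  by_cases hli : LinearIndependent k ![y, z]
  · have h1 : Submodule.span k (Set.range ![y, z]) = r := by
      apply Submodule.eq_of_le_of_finrank_le
      · rw [Submodule.span_le]
        rintro _ ⟨i, rfl⟩
        fin_cases i
        · exact hyr
        · exact hzr
      · rw [finrank_span_eq_card hli, hr.1]
        simp
    rw [← h1, Submodule.span_le]
    rintro _ ⟨i, rfl⟩
    fin_cases i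
    · exact Submodule.mem_sup_left hyℓ
    · exact Submodule.mem_sup_right hzm
  · have hym : y ∈ m := by
      rw [LinearIndependent.pair_iff' hy0] at hli
      push Not at hli
      obtain ⟨a, rfl⟩ := hli
      exact (m.smul_mem_iff (fun h => hz0 (by rw [h, zero_smul]))).mp hzm
    have h4 : ℓ ⊔ m = LinearMap.ker (grad f y) := by
      apply Submodule.eq_of_le_of_finrank_le
      · exact sup_le (hℓ.le_ker hyℓ) (hm.le_ker hym)
      · rw [h3, finrank_ker_grad hf hy0 (hℓ.2 _ hyℓ)]
    rw [h4]
    exact hr.le_ker hyr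

end Lines

section Skew

variable {k : Type*} [Field k]

theorem eval_aeval {σ τ : Type*} (f : MvPolynomial σ k) (δ : σ → MvPolynomial τ k) (x : τ → k) :
    eval x (aeval δ f) = eval (fun j => eval x (δ j)) f := by
  have h : ((aeval x).comp (aeval δ) : MvPolynomial σ k →ₐ[k] k) =
      aeval (fun j => eval x (δ j)) := by
    apply MvPolynomial.algHom_ext
    intro i
    simp [MvPolynomial.aeval_eq_eval]
  exact DFunLike.congr_fun h f

theorem totalDegree_aeval_le {f : MvPolynomial (Fin 4) k} {n : ℕ}
    (hf : f.IsHomogeneous (n + 1)) (δ b : Fin 4 → MvPolynomial (Fin 4) k)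
    (hδ : ∀ j, (δ j).totalDegree ≤ 1) (hb : ∀ j, (b j).totalDegree ≤ 0)
    (h0 : aeval δ f = 0) : (aeval (δ + b) f).totalDegree ≤ n := by
  have hgood := lineRestr_good (fun i => restrictTotalDegree (Fin 4) k i)
    (by simp [mem_restrictTotalDegree])
    (fun i j x y hx hy => by
      rw [mem_restrictTotalDegree] at *
      exact (totalDegree_mul _ _).trans (add_le_add hx hy)) (α := 1) (β := 0) (v := δ) (u := b)
    (fun i => by rw [mem_restrictTotalDegree]; exact hδ i)
    (fun i => by rw [mem_restrictTotalDegree]; exact hb i) hf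
  have h1 := eval_lineRestr f δ b 1
  rw [one_smul] at h1
  rw [← h1, Polynomial.eval_eq_sum_range' (Nat.lt_succ_of_le hgood.1)]
  refine totalDegree_finsetSum_le fun j hj => ?_
  rw [one_pow, mul_one]
  rcases Nat.eq_zero_or_pos j with rfl | hj0
  · rw [coeff_zero_lineRestr, h0]
    simp
  · have hj' : j ≤ n + 1 := by
      rw [Finset.mem_range] at hj
      omega
    have := hgood.2 (n + 1 - j) j (by omega)
    rw [mem_restrictTotalDegree] at this
    omega

theorem eq_zero_of_coprime_combination {n : ℕ} {a b p q : Polynomial k} (hn : 2 ≤ n)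
    (hab : IsCoprime a b) (htop : a.coeff n ≠ 0 ∨ b.coeff n ≠ 0) (hp : p.natDegree ≤ 1)
    (hq : q.natDegree ≤ 1) (h : a * p + b * q = 0) : p = 0 ∧ q = 0 := by
  have ha0 : ∀ {a b p q : Polynomial k}, IsCoprime a b → b.coeff n ≠ 0 → p.natDegree ≤ 1 →
      a * p + b * q = 0 → p = 0 ∧ q = 0 := by
    intro a b p q hab hb hp h
    have hdvd : b ∣ p := by
      have h' : b ∣ a * p := ⟨-q, by linear_combination h⟩
      exact hab.symm.dvd_of_dvd_mul_left h'
    have hbn : n ≤ b.natDegree := Polynomial.le_natDegree_of_ne_zero hb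
    have hp0 : p = 0 := by
      by_contra hp0
      have := Polynomial.natDegree_le_of_dvd hdvd hp0
      omega
    refine ⟨hp0, ?_⟩
    have hb0 : b ≠ 0 := by rintro rfl; simp at hb
    rw [hp0, mul_zero, zero_add] at h
    exact (mul_eq_zero.mp h).resolve_left hb0
  rcases htop with h1 | h1
  · exact (ha0 hab.symm h1 hq (by rw [add_comm]; exact h)).symm
  · exact ha0 hab h1 hp h

variable [IsAlgClosed k] {f : MvPolynomial (Fin 4) k} {n : ℕ}

theorem isCoprime_of_no_common_root {a b : Polynomial k}
    (h : ∀ t, a.eval t = 0 → b.eval t = 0 → False) : IsCoprime a b := by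
  rw [Polynomial.isCoprime_iff_aeval_ne_zero_of_isAlgClosed k k]
  intro t
  by_contra! hcon
  simp only [Polynomial.coe_aeval_eq_eval] at hcon
  exact h t hcon.1 hcon.2

theorem coprime_restr (hf : IsSmoothSurface f (n + 1)) {W : Submodule k (Fin 4 → k)}
    (hW : IsLineOn f W) {v u a b : Fin 4 → k} (hvu : LinearIndependent k ![u, v])
    (hv : v ∈ W) (hu : u ∈ W) (hsup : W ⊔ Submodule.span k {a, b} = ⊤) :
    IsCoprime (lineRestr (dirDeriv f a) v u) (lineRestr (dirDeriv f b) v u) ∧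
      (eval u (dirDeriv f a) ≠ 0 ∨ eval u (dirDeriv f b) ≠ 0) := by
  have key : ∀ x ∈ W, x ≠ 0 → grad f x a = 0 → grad f x b = 0 → False := by
    intro x hx hx0 ha hb
    refine not_grad_zero_of_sup hf hx0 (hW.2 x hx) hsup
      (fun y hy => grad_eq_zero_of_mem hW.2 hx hy) ?_
    intro y hy
    obtain ⟨s, t, rfl⟩ := Submodule.mem_span_pair.mp hy
    simp [ha, hb]
  have hli := LinearIndependent.pair_iff.mp hvu
  refine ⟨isCoprime_of_no_common_root fun t h1 h2 => ?_, ?_⟩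
  · rw [eval_lineRestr_dirDeriv] at h1 h2
    refine key _ (W.add_mem hv (W.smul_mem t hu)) ?_ h1 h2
    intro h
    have := hli t 1 (by rw [one_smul, add_comm]; exact h)
    exact one_ne_zero this.2
  · by_contra! h
    refine key u hu ?_ h.1 h.2
    rintro rfl
    have := hli 1 0 (by simp)
    exact one_ne_zero this.1

theorem card_skew_le (hf : IsSmoothSurface f (n + 1)) (hn : 2 ≤ n)
    {ℓ : Submodule k (Fin 4 → k)} (hℓ : IsLineOn f ℓ) (F : Finset (Submodule k (Fin 4 → k)))
    (hF : ∀ m ∈ F, IsLineOn f m ∧ ℓ ⊓ m = ⊥) : F.card ≤ n ^ 4 := by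
  classical
  obtain ⟨r0, hr0⟩ := Submodule.exists_isCompl ℓ
  have hr0rank : Module.finrank k r0 = 2 := by
    have := Submodule.finrank_add_eq_of_isCompl hr0
    rw [hℓ.1] at this
    simp at this
    omega
  obtain ⟨e1, e2, he12, hli12⟩ := exists_basis_pair hr0rank
  obtain ⟨e3, e4, he34, hli34⟩ := exists_basis_pair hℓ.1
  have he3 : e3 ∈ ℓ := by rw [he34]; exact Submodule.subset_span (by simp)
  have he4 : e4 ∈ ℓ := by rw [he34]; exact Submodule.subset_span (by simp)
  have he1 : e1 ∈ r0 := by rw [he12]; exact Submodule.subset_span (by simp)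
  have he2 : e2 ∈ r0 := by rw [he12]; exact Submodule.subset_span (by simp)
  have hcoord : ∀ e : Fin 4 → k, ∀ m ∈ F, ∃ z w : k, e + z • e3 + w • e4 ∈ m := by
    intro e m hm
    have htop := sup_eq_top_of_skew hℓ.1 (hF m hm).1.1 (hF m hm).2
    obtain ⟨x, hx, y, hy, hxy⟩ := Submodule.mem_sup.mp (htop ▸ Submodule.mem_top : e ∈ ℓ ⊔ m)
    rw [he34] at hx
    obtain ⟨z, w, rfl⟩ := Submodule.mem_span_pair.mp hx
    refine ⟨-z, -w, ?_⟩
    convert hy using 1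
    rw [← hxy]
    module
  choose! z w hzw using hcoord
  let ζ : Submodule k (Fin 4 → k) → (Fin 4 → k) := fun m => ![z e1 m, z e2 m, w e1 m, w e2 m]
  let v0 : (Fin 4 → k) → (Fin 4 → k) := fun x => e1 + x 0 • e3 + x 2 • e4
  let u0 : (Fin 4 → k) → (Fin 4 → k) := fun x => e2 + x 1 • e3 + x 3 • e4
  have hv0 : ∀ m ∈ F, v0 (ζ m) ∈ m := fun m hm => hzw e1 m hm
  have hu0 : ∀ m ∈ F, u0 (ζ m) ∈ m := fun m hm => hzw e2 m hm
  have hli : ∀ x, LinearIndependent k ![u0 x, v0 x] := by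
    intro x
    rw [LinearIndependent.pair_iff]
    intro s t hst
    have h1 : t • e1 + s • e2 ∈ ℓ := by
      have : t • e1 + s • e2 = -((s * x 1 + t * x 0) • e3 + (s * x 3 + t * x 2) • e4) := by
        rw [eq_neg_iff_add_eq_zero, ← hst]
        simp only [u0, v0]
        module
      rw [this]
      exact ℓ.neg_mem (ℓ.add_mem (ℓ.smul_mem _ he3) (ℓ.smul_mem _ he4))
    have h2 : t • e1 + s • e2 = 0 :=
      (Submodule.disjoint_def.mp hr0.disjoint) _ h1
        (r0.add_mem (r0.smul_mem _ he1) (r0.smul_mem _ he2))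
    have := LinearIndependent.pair_iff.mp hli12 t s h2
    exact ⟨this.2, this.1⟩
  have hinj : Set.InjOn ζ F := by
    intro m hm m' hm' h
    refine eq_of_common_pair (hF m hm).1.1 (hF m' hm').1.1 (hli (ζ m)) (hu0 m hm) (hv0 m hm) ?_ ?_
    · rw [h]; exact hu0 m' hm'
    · rw [h]; exact hv0 m' hm'
  obtain ⟨Y, hY⟩ := Infinite.exists_subset_card_eq k (n + 2)
  let δ : k → Fin 4 → MvPolynomial (Fin 4) k := fun y j =>
    (X 0 + C y * X 1) * C (e3 j) + (X 2 + C y * X 3) * C (e4 j)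
  let g : Y → MvPolynomial (Fin 4) k := fun y =>
    aeval (δ y.1 + fun j => C (e1 j + y.1 * e2 j)) f
  have hδeval : ∀ (y : k) (x : Fin 4 → k), (fun j => eval x (δ y j)) =
      (x 0 + y * x 1) • e3 + (x 2 + y * x 3) • e4 := by
    intro y x
    funext j
    simp [δ]
  have hg : ∀ (y : Y) (x : Fin 4 → k), eval x (g y) = eval (v0 x + y.1 • u0 x) f := by
    intro y x
    simp only [g]
    rw [eval_aeval]
    congr 2
    funext j
    have := congrFun (hδeval y.1 x) j
    simp only [Pi.add_apply, Pi.smul_apply, smul_eq_mul] at this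
    simp only [Pi.add_apply, map_add, map_mul, this, eval_C, v0, u0, Pi.smul_apply, smul_eq_mul]
    ring
  rw [← Finset.card_image_of_injOn hinj]
  refine card_le_of_jacobian (by omega) (F.image ζ) g ?_ ?_ ?_
  · intro y
    refine totalDegree_aeval_le hf.2.1 _ _ ?_ ?_ ?_
    · intro j
      have hX : ∀ a b : Fin 4, (X a + C y.1 * X b : MvPolynomial (Fin 4) k).totalDegree ≤ 1 := by
        intro a b
        refine (totalDegree_add _ _).trans (max_le (totalDegree_X a).le ?_)
        refine (totalDegree_mul _ _).trans ?_
        rw [totalDegree_C, totalDegree_X]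
      refine (totalDegree_add _ _).trans (max_le ?_ ?_) <;>
      · refine (totalDegree_mul _ _).trans ?_
        rw [totalDegree_C]
        exact hX _ _
    · intro j
      exact (totalDegree_C _).le
    · apply MvPolynomial.funext
      intro x
      rw [eval_aeval, hδeval, map_zero]
      exact hℓ.2 _ (ℓ.add_mem (ℓ.smul_mem _ he3) (ℓ.smul_mem _ he4))
  · intro v hv y
    obtain ⟨m, hm, rfl⟩ := Finset.mem_image.mp hv
    rw [hg]
    exact (hF m hm).1.2 _ (m.add_mem (hv0 m hm) (m.smul_mem _ (hu0 m hm)))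
  · intro v hv η hη
    obtain ⟨m, hm, rfl⟩ := Finset.mem_image.mp hv
    set x := ζ m with hx
    have hgrad : ∀ y : Y, grad f (v0 x + y.1 • u0 x)
        ((η 0 + y.1 * η 1) • e3 + (η 2 + y.1 * η 3) • e4) = 0 := by
      intro y
      rw [← hη y, ← coeff_one_lineRestr', ← coeff_one_lineRestr_grad]
      congr 1
      apply Polynomial.funext
      intro t
      rw [eval_lineRestr', eval_lineRestr', hg]
      congr 2
      simp only [v0, u0, Pi.add_apply, Pi.smul_apply, smul_eq_mul]
      module
    obtain ⟨hcop, htop⟩ := coprime_restr hf (hF m hm).1 (hli x) (hv0 m hm) (hu0 m hm)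
      (a := e3) (b := e4) (by
        rw [← he34, sup_comm]
        exact sup_eq_top_of_skew hℓ.1 (hF m hm).1.1 (hF m hm).2)
    have hd := fun e => isHomogeneous_dirDeriv hf.2.1 e
    rw [Nat.add_sub_cancel] at hd
    rw [← coeff_natDegree_lineRestr (hd e3) (v0 x), ← coeff_natDegree_lineRestr (hd e4) (v0 x)]
      at htop
    have hdl : ∀ a b : k, (Polynomial.C a + Polynomial.X * Polynomial.C b).natDegree ≤ 1 := by
      intro a b
      compute_degree
    obtain ⟨h1, h2⟩ := eq_zero_of_coprime_combination hn hcop htop (hdl (η 0) (η 1))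
      (hdl (η 2) (η 3)) (by
        apply Polynomial.eq_zero_of_natDegree_lt_card_of_eval_eq_zero' _ Y
        · intro y hy
          have := hgrad ⟨y, hy⟩
          rw [map_add, map_smul, map_smul] at this
          simp only [Polynomial.eval_add, Polynomial.eval_mul, eval_lineRestr_dirDeriv,
            Polynomial.eval_C, Polynomial.eval_X]
          rw [← this, smul_eq_mul, smul_eq_mul]
          ring
        · rw [hY]
          refine lt_of_le_of_lt (b := n + 1) ?_ (by omega)
          refine Polynomial.natDegree_add_le_of_degree_le ?_ ?_ <;>
            exact Polynomial.natDegree_mul_le.trans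
              (add_le_add (natDegree_lineRestr_le (hd _) _ _) (hdl _ _)))
    have hc : ∀ a b : k, Polynomial.C a + Polynomial.X * Polynomial.C b = 0 → a = 0 ∧ b = 0 := by
      intro a b h
      have h0 := congrArg (Polynomial.coeff · 0) h
      have h1 := congrArg (Polynomial.coeff · 1) h
      simp [Polynomial.coeff_C_succ] at h0 h1
      exact ⟨h0, h1⟩
    obtain ⟨h01, h02⟩ := hc _ _ h1
    obtain ⟨h03, h04⟩ := hc _ _ h2
    funext i
    fin_cases i <;> assumption

end Skew

section Transversals

variable {k : Type*} [Field k]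

theorem polynomial_eval_aeval {σ : Type*} (g : MvPolynomial σ k) (q : σ → Polynomial k) (t : k) :
    (aeval q g).eval t = eval (fun j => (q j).eval t) g := by
  have h : ((Polynomial.aeval t).comp (aeval q) : MvPolynomial σ k →ₐ[k] k) =
      aeval (fun j => (q j).eval t) := by
    apply MvPolynomial.algHom_ext
    intro i
    simp [Polynomial.coe_aeval_eq_eval]
  have := DFunLike.congr_fun h g
  simpa [Polynomial.coe_aeval_eq_eval, MvPolynomial.aeval_eq_eval] using this

theorem eval_coeff_lineRestr {σ : Type*} (g : MvPolynomial σ k) (p q : σ → Polynomial k) (t : k)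
    (i : ℕ) : ((lineRestr g p q).coeff i).eval t =
      (lineRestr g (fun j => (p j).eval t) (fun j => (q j).eval t)).coeff i := by
  have h := map_lineRestr (Polynomial.aeval (R := k) t) g p q
  have h2 := congrArg (Polynomial.coeff · i) h
  simpa [Polynomial.coe_aeval_eq_eval] using h2

theorem natDegree_coeff_lineRestr_le {σ : Type*} {g : MvPolynomial σ k} {d α β i j : ℕ}
    (hg : g.IsHomogeneous d) {p q : σ → Polynomial k} (hp : ∀ j, (p j).natDegree ≤ α)
    (hq : ∀ j, (q j).natDegree ≤ β) (hij : j + i = d) :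
    ((lineRestr g p q).coeff i).natDegree ≤ α * j + β * i := by
  have h := (lineRestr_good (fun i : ℕ => Polynomial.degreeLE k (i : WithBot ℕ))
    (by simp [Polynomial.mem_degreeLE])
    (fun i j x y hx hy => by
      rw [Polynomial.mem_degreeLE, ← Polynomial.natDegree_le_iff_degree_le] at *
      exact Polynomial.natDegree_mul_le.trans (add_le_add hx hy)) (α := α) (β := β) (v := p)
    (u := q)
    (fun i => by rw [Polynomial.mem_degreeLE, ← Polynomial.natDegree_le_iff_degree_le]; exact hp i)
    (fun i => by rw [Polynomial.mem_degreeLE, ← Polynomial.natDegree_le_iff_degree_le]; exact hq i)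
    hg).2 j i hij
  rwa [Polynomial.mem_degreeLE, ← Polynomial.natDegree_le_iff_degree_le] at h

theorem mem_span_of_linearIndependent_pair {W : Submodule k (Fin 4 → k)}
    (hW : Module.finrank k W = 2) {x y v : Fin 4 → k} (hli : LinearIndependent k ![x, y])
    (hx : x ∈ W) (hy : y ∈ W) (hv : v ∈ W) : ∃ s t : k, s • x + t • y = v := by
  have h : Submodule.span k {x, y} = W := by
    apply Submodule.eq_of_le_of_finrank_le
    · rw [Submodule.span_le]
      rintro _ (rfl | rfl)
      · exact hx
      · exact hy
    · have h := finrank_span_eq_card hli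
      rw [Matrix.range_cons, Matrix.range_cons, Matrix.range_empty, Set.union_empty] at h
      rw [hW]
      exact h.ge
  rw [← h] at hv
  exact Submodule.mem_span_pair.mp hv

theorem exists_linearIndependent_pair {W : Submodule k (Fin 4 → k)}
    (hW : Module.finrank k W = 2) {x : Fin 4 → k} (hx : x ∈ W) (hx0 : x ≠ 0) :
    ∃ y ∈ W, LinearIndependent k ![x, y] := by
  have h : 1 < Module.finrank k W := by omega
  obtain ⟨y, hli⟩ := exists_linearIndependent_pair_of_one_lt_finrank h
    (x := ⟨x, hx⟩) (fun h => hx0 (congrArg Subtype.val h))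
  refine ⟨y, y.2, ?_⟩
  rw [LinearIndependent.pair_iff] at hli ⊢
  intro s t hst
  exact hli s t (Subtype.ext hst)

theorem linearIndependent_pair_of_skew {ℓ r : Submodule k (Fin 4 → k)} (h : ℓ ⊓ r = ⊥)
    {x y : Fin 4 → k} (hx : x ∈ ℓ) (hy : y ∈ r) (hx0 : x ≠ 0) (hy0 : y ≠ 0) :
    LinearIndependent k ![x, y] := by
  rw [LinearIndependent.pair_iff' hx0]
  rintro a rfl
  have : a • x ∈ ℓ ⊓ r := ⟨ℓ.smul_mem _ hx, hy⟩
  rw [h] at this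
  exact hy0 this

variable [IsAlgClosed k] {f : MvPolynomial (Fin 4) k} {n : ℕ}

theorem not_grad_zero_of_skew (hf : IsSmoothSurface f (n + 1)) {ℓ r : Submodule k (Fin 4 → k)}
    (hℓ : Module.finrank k ℓ = 2) (hr : IsLineOn f r) (hskew : ℓ ⊓ r = ⊥) {x : Fin 4 → k}
    (hx : x ∈ r) (hx0 : x ≠ 0) : ∃ u ∈ ℓ, grad f x u ≠ 0 := by
  by_contra! h
  exact not_grad_zero_of_sup hf hx0 (hr.2 x hx) (sup_eq_top_of_skew hℓ hr.1 hskew)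
    h (fun y hy => grad_eq_zero_of_mem hr.2 hx hy)

theorem card_transversals_aux (hf : IsSmoothSurface f (n + 1)) (hn : 2 ≤ n)
    {ℓ r : Submodule k (Fin 4 → k)} (hℓ : IsLineOn f ℓ) (hr : IsLineOn f r) (hskew : ℓ ⊓ r = ⊥)
    {e1 e2 e3 e4 : Fin 4 → k} (he1 : e1 ∈ r) (he2 : e2 ∈ r)
    (h12 : LinearIndependent k ![e2, e1]) (he3 : e3 ∈ ℓ) (he4 : e4 ∈ ℓ)
    (h34 : LinearIndependent k ![e3, e4]) (hD : grad f e3 e2 ≠ 0)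
    (F : Finset (Submodule k (Fin 4 → k)))
    (hF : ∀ m ∈ F, IsLineOn f m ∧ m ⊓ ℓ ≠ ⊥ ∧ m ⊓ r ≠ ⊥ ∧ e3 ∉ m) :
    F.card ≤ n ^ 2 + 1 ∧ (F.card = n ^ 2 + 1 →
      ∀ i, 2 ≤ i → i < n → (lineRestr f e4 e2).coeff i = 0) := by
  classical
  have hd := fun e => isHomogeneous_dirDeriv hf.2.1 e
  rw [Nat.add_sub_cancel] at hd
  set a := lineRestr (dirDeriv f e1) e4 e3 with ha
  set b := lineRestr (dirDeriv f e2) e4 e3 with hb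
  have hadeg : a.natDegree ≤ n := natDegree_lineRestr_le (hd _) _ _
  have hbdeg : b.natDegree ≤ n := natDegree_lineRestr_le (hd _) _ _
  have hbn : b.coeff n ≠ 0 := by
    rw [hb, coeff_natDegree_lineRestr (hd e2)]
    exact hD
  have hspan : ∀ x ∈ r, ∃ s t : k, s • e1 + t • e2 = x := fun x hx => by
    obtain ⟨s, t, h⟩ := mem_span_of_linearIndependent_pair hr.1 h12 he2 he1 hx
    exact ⟨t, s, by rw [add_comm]; exact h⟩
  have hcop : IsCoprime a b := by
    apply isCoprime_of_no_common_root
    intro t h1 h2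
    rw [ha, eval_lineRestr_dirDeriv] at h1
    rw [hb, eval_lineRestr_dirDeriv] at h2
    obtain ⟨u, hu, hne⟩ := not_grad_zero_of_skew hf hr.1 hℓ (by rw [inf_comm]; exact hskew)
      (x := e4 + t • e3) (ℓ.add_mem he4 (ℓ.smul_mem t he3)) (by
        intro h
        have := LinearIndependent.pair_iff.mp h34 t 1 (by rw [one_smul, add_comm]; exact h)
        exact one_ne_zero this.2)
    obtain ⟨s, t, rfl⟩ := hspan u hu
    apply hne
    rw [map_add, map_smul, map_smul, h1, h2]
    simp
  let p : Fin 4 → Polynomial k := fun j => Polynomial.C (e4 j) + Polynomial.X * Polynomial.C (e3 j)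
  let q : Fin 4 → Polynomial k := fun j => a * Polynomial.C (e2 j) - b * Polynomial.C (e1 j)
  have hp : ∀ t, (fun j => (p j).eval t) = e4 + t • e3 := by
    intro t
    funext j
    simp only [p, Polynomial.eval_add, Polynomial.eval_C, Polynomial.eval_mul, Polynomial.eval_X,
      Pi.add_apply, Pi.smul_apply, smul_eq_mul]
  have hq : ∀ t, (fun j => (q j).eval t) = a.eval t • e2 - b.eval t • e1 := by
    intro t
    funext j
    simp [q]
  have hp1 : ∀ j, (p j).natDegree ≤ 1 := fun j => by
    simp only [p]
    compute_degree
  have hqn : ∀ j, (q j).natDegree ≤ n := fun j => by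
    refine (Polynomial.natDegree_sub_le _ _).trans (max_le ?_ ?_)
    · exact (Polynomial.natDegree_mul_C_le _ _).trans hadeg
    · exact (Polynomial.natDegree_mul_C_le _ _).trans hbdeg
  have hcomb : ∀ s t : k, s • e2 - t • e1 = 0 → s = 0 ∧ t = 0 := by
    intro s t h
    have := LinearIndependent.pair_iff.mp h12 s (-t) (by rw [neg_smul, ← sub_eq_add_neg]; exact h)
    exact ⟨this.1, neg_eq_zero.mp this.2⟩
  have hqr : ∀ t, a.eval t • e2 - b.eval t • e1 ∈ r := fun t =>
    r.sub_mem (r.smul_mem _ he2) (r.smul_mem _ he1)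
  have hq0 : ∀ t, a.eval t • e2 - b.eval t • e1 ≠ 0 := by
    intro t h
    obtain ⟨h1, h2⟩ := hcomb _ _ h
    obtain ⟨c, c', hcc⟩ := hcop
    have := congrArg (Polynomial.eval t) hcc
    simp [h1, h2] at this
  have hkey : ∀ x ∈ r, x ≠ 0 → grad f x e3 = 0 → grad f x e4 = 0 → False := by
    intro x hx hx0 h3 h4
    obtain ⟨u, hu, hne⟩ := not_grad_zero_of_skew hf hℓ.1 hr hskew hx hx0
    obtain ⟨s, t, rfl⟩ := mem_span_of_linearIndependent_pair hℓ.1 h34 he3 he4 hu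
    apply hne
    rw [map_add, map_smul, map_smul, h3, h4]
    simp
  have hp0 : ∀ t : k, e4 + t • e3 ≠ 0 := by
    intro t h
    have := LinearIndependent.pair_iff.mp h34 t 1 (by rw [one_smul, add_comm]; exact h)
    exact one_ne_zero this.2
  have hτ : ∀ m ∈ F, ∃ t : k, e4 + t • e3 ∈ m ∧ a.eval t • e2 - b.eval t • e1 ∈ m := by
    intro m hm
    obtain ⟨hmS, hmℓ, hmr, h3m⟩ := hF m hm
    obtain ⟨x, ⟨hxm, hxℓ⟩, hx0⟩ := Submodule.exists_mem_ne_zero_of_ne_bot hmℓ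
    obtain ⟨y, ⟨hym, hyr⟩, hy0⟩ := Submodule.exists_mem_ne_zero_of_ne_bot hmr
    obtain ⟨s, t, rfl⟩ := mem_span_of_linearIndependent_pair hℓ.1 h34 he3 he4 hxℓ
    obtain ⟨c1, c2, rfl⟩ := hspan y hyr
    have ht : t ≠ 0 := by
      rintro rfl
      rw [zero_smul, add_zero] at hxm hx0
      have hs : s ≠ 0 := by
        rintro rfl
        exact hx0 (zero_smul _ _)
      exact h3m ((m.smul_mem_iff hs).mp hxm)
    have hpm : e4 + (s / t) • e3 ∈ m := by
      rw [← m.smul_mem_iff ht, smul_add, smul_smul, mul_div_cancel₀ _ ht, add_comm]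
      exact hxm
    refine ⟨s / t, hpm, ?_⟩
    have hz := grad_eq_zero_of_mem hmS.2 hpm hym
    rw [map_add, map_smul, map_smul, ← eval_lineRestr_dirDeriv, ← eval_lineRestr_dirDeriv,
      ← ha, ← hb, smul_eq_mul, smul_eq_mul] at hz
    by_cases hc : c2 = 0
    · have hc1 : c1 ≠ 0 := by
        rintro rfl
        apply hy0
        rw [hc]
        simp
      rw [← m.smul_mem_iff hc1]
      have : c1 • (a.eval (s / t) • e2 - b.eval (s / t) • e1) =
          (-b.eval (s / t)) • (c1 • e1 + c2 • e2) := by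
        have h' : (c1 * a.eval (s / t) + c2 * b.eval (s / t)) • e2 = 0 := by rw [hz, zero_smul]
        rw [← sub_eq_zero, ← h']
        module
      rw [this]
      exact m.smul_mem _ hym
    · rw [← m.smul_mem_iff hc]
      have : c2 • (a.eval (s / t) • e2 - b.eval (s / t) • e1) =
          (a.eval (s / t)) • (c1 • e1 + c2 • e2) := by
        have h' : (c1 * a.eval (s / t) + c2 * b.eval (s / t)) • e1 = 0 := by rw [hz, zero_smul]
        rw [← sub_eq_zero, ← neg_eq_zero, ← h']
        module
      rw [this]
      exact m.smul_mem _ hym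
  choose! τ hτp hτq using hτ
  have hinj : Set.InjOn τ F := by
    intro m hm m' hm' h
    refine eq_of_common_pair (hF m hm).1.1 (hF m' hm').1.1
      (linearIndependent_pair_of_skew hskew (ℓ.add_mem he4 (ℓ.smul_mem (τ m) he3)) (hqr (τ m))
        (hp0 _) (hq0 _)) (hτp m hm) (hτq m hm) ?_ ?_
    · rw [h]; exact hτp m' hm'
    · rw [h]; exact hτq m' hm'
  rw [← Finset.card_image_of_injOn hinj]
  refine ⟨?_, ?_⟩
  · set A' := aeval q (dirDeriv f e3) with hA
    set B' := aeval q (dirDeriv f e4) with hB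
    have hAe : ∀ t, A'.eval t = grad f (a.eval t • e2 - b.eval t • e1) e3 := fun t => by
      rw [hA, polynomial_eval_aeval, hq, grad_apply]
    have hBe : ∀ t, B'.eval t = grad f (a.eval t • e2 - b.eval t • e1) e4 := fun t => by
      rw [hB, polynomial_eval_aeval, hq, grad_apply]
    obtain ⟨hAdeg, hAtop⟩ := aeval_polynomial_top (hd e3) hqn
    obtain ⟨hBdeg, hBtop⟩ := aeval_polynomial_top (hd e4) hqn
    rw [← hA] at hAdeg hAtop
    rw [← hB] at hBdeg hBtop
    have hne : Polynomial.X * A' + B' ≠ 0 := by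
      intro h
      have hB' : B' = -(Polynomial.X * A') := (neg_eq_of_add_eq_zero_right h).symm
      have hA0 : A'.degree = 0 := by
        by_contra hdeg
        obtain ⟨t, ht⟩ := IsAlgClosed.exists_root A' hdeg
        refine hkey _ (hqr t) (hq0 t) ((hAe t).symm.trans ht) ?_
        rw [← hBe, hB', Polynomial.eval_neg, Polynomial.eval_mul, ht.eq_zero]
        simp
      have hAn : A'.natDegree = 0 := Polynomial.natDegree_eq_of_degree_eq_some hA0
      have hnn : 4 ≤ n * n := Nat.mul_le_mul hn hn
      have hA1 : A'.coeff (n * n) = 0 := Polynomial.coeff_eq_zero_of_natDegree_lt (by omega)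
      have hB1 : B'.coeff (n * n) = 0 := by
        rw [hB']
        apply Polynomial.coeff_eq_zero_of_natDegree_lt
        rw [Polynomial.natDegree_neg]
        refine lt_of_le_of_lt Polynomial.natDegree_mul_le ?_
        rw [hAn, Polynomial.natDegree_X]
        omega
      have hqtop : (fun j => (q j).coeff n) = a.coeff n • e2 - b.coeff n • e1 := by
        funext j
        simp [q]
      rw [hA1, hqtop] at hAtop
      rw [hB1, hqtop] at hBtop
      refine hkey _ (r.sub_mem (r.smul_mem _ he2) (r.smul_mem _ he1)) ?_ hAtop.symm hBtop.symm
      intro h0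
      exact hbn (hcomb _ _ h0).2
    have hroots : F.image τ ⊆ (Polynomial.X * A' + B').roots.toFinset := by
      intro t ht
      obtain ⟨m, hm, rfl⟩ := Finset.mem_image.mp ht
      rw [Multiset.mem_toFinset, Polynomial.mem_roots hne, Polynomial.IsRoot, Polynomial.eval_add,
        Polynomial.eval_mul, Polynomial.eval_X, hAe, hBe]
      have := grad_eq_zero_of_mem (hF m hm).1.2 (hτq m hm) (hτp m hm)
      rw [map_add, map_smul, smul_eq_mul, add_comm] at this
      exact this
    refine (Finset.card_le_card hroots).trans ((Multiset.toFinset_card_le _).trans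
      ((Polynomial.card_roots' _).trans ?_))
    refine Polynomial.natDegree_add_le_of_degree_le ?_ ?_
    · refine Polynomial.natDegree_mul_le.trans ?_
      rw [Polynomial.natDegree_X, sq]
      omega
    · rw [sq]
      omega
  · intro hcard i hi2 hin
    have hΦ : (lineRestr f p q).coeff i = 0 := by
      refine Polynomial.eq_zero_of_natDegree_lt_card_of_eval_eq_zero' _ (F.image τ) ?_ ?_
      · intro t ht
        obtain ⟨m, hm, rfl⟩ := Finset.mem_image.mp ht
        rw [eval_coeff_lineRestr, hp, hq, lineRestr_eq_zero (hF m hm).1.2 (hτp m hm) (hτq m hm),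
          Polynomial.coeff_zero]
      · rw [hcard]
        refine lt_of_le_of_lt (natDegree_coeff_lineRestr_le hf.2.1 (j := n + 1 - i) hp1 hqn
          (by omega)) ?_
        obtain ⟨j, rfl⟩ : ∃ j, n = i + 1 + j := ⟨n - (i + 1), by omega⟩
        have : i + 1 + j + 1 - i = j + 2 := by omega
        rw [this]
        nlinarith
    have hci : b ∣ (lineRestr f p (fun j => Polynomial.C (e2 j))).coeff i := by
      refine (hcop.symm.pow_right (n := i)).dvd_of_dvd_mul_left ?_
      rw [← Ideal.mem_span_singleton, ← Ideal.Quotient.eq_zero_iff_mem]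
      let φ := Ideal.Quotient.mkₐ k (Ideal.span {b})
      have h1 := congrArg (Polynomial.coeff · i) (map_lineRestr φ f p q)
      have h2 := congrArg (Polynomial.coeff · i)
        (map_lineRestr φ f p (fun j => Polynomial.C (e2 j)))
      have hφb : φ b = 0 := Ideal.Quotient.eq_zero_iff_mem.mpr (Ideal.mem_span_singleton_self b)
      have h3 : (fun j => φ (q j)) = φ a • (fun j => φ (Polynomial.C (e2 j))) := by
        funext j
        simp only [q, map_sub, map_mul, hφb, zero_mul, sub_zero, Pi.smul_apply, smul_eq_mul]
      simp only [Polynomial.coeff_map] at h1 h2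
      rw [h3, lineRestr_smul, ← h2, hΦ, map_zero] at h1
      change φ _ = 0
      rw [map_mul, map_pow]
      exact h1.symm
    have hc0 : (lineRestr f p (fun j => Polynomial.C (e2 j))).coeff i = 0 := by
      by_contra hne
      have h1 := Polynomial.natDegree_le_of_dvd hci hne
      have h2 := Polynomial.le_natDegree_of_ne_zero hbn
      have h3 := natDegree_coeff_lineRestr_le hf.2.1 (j := n + 1 - i) (i := i) hp1
        (q := fun j => Polynomial.C (e2 j)) (β := 0) (by simp) (by omega)
      omega
    have := eval_coeff_lineRestr f p (fun j => Polynomial.C (e2 j)) 0 i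
    rw [hc0, hp] at this
    simpa using this.symm

/-- Two skew lines of `S` have at most `n ^ 2 + 1` common transversals on `S`; equality forces
the mixed terms of `f` to vanish. -/
theorem card_transversals (hf : IsSmoothSurface f (n + 1)) (hn : 2 ≤ n)
    {ℓ r : Submodule k (Fin 4 → k)} (hℓ : IsLineOn f ℓ) (hr : IsLineOn f r) (hskew : ℓ ⊓ r = ⊥)
    (F : Finset (Submodule k (Fin 4 → k)))
    (hF : ∀ m ∈ F, IsLineOn f m ∧ m ⊓ ℓ ≠ ⊥ ∧ m ⊓ r ≠ ⊥) :
    F.card ≤ n ^ 2 + 1 ∧ (F.card = n ^ 2 + 1 →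
      ∀ v ∈ ℓ, ∀ u ∈ r, eval (v + u) f = grad f v u + grad f u v) := by
  classical
  obtain ⟨e3, he3, hne3⟩ := exists_mem_not_mem_finset ℓ (insert ⊥ F) (by
    intro m hm hle
    rcases Finset.mem_insert.mp hm with rfl | hm
    · have := Submodule.finrank_mono hle
      rw [hℓ.1, finrank_bot] at this
      omega
    · have h : ℓ = m := Submodule.eq_of_le_of_finrank_le hle (by rw [hℓ.1, (hF m hm).1.1])
      exact (hF m hm).2.2 (h ▸ hskew))
  have he30 : e3 ≠ 0 := fun h => hne3 ⊥ (Finset.mem_insert_self _ _) (by simp [h])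
  have hF' : ∀ m ∈ F, IsLineOn f m ∧ m ⊓ ℓ ≠ ⊥ ∧ m ⊓ r ≠ ⊥ ∧ e3 ∉ m := fun m hm =>
    ⟨(hF m hm).1, (hF m hm).2.1, (hF m hm).2.2, hne3 m (Finset.mem_insert_of_mem hm)⟩
  have hmain : ∀ v ∈ ℓ, ∀ u ∈ r, LinearIndependent k ![e3, v] → grad f e3 u ≠ 0 →
      F.card ≤ n ^ 2 + 1 ∧ (F.card = n ^ 2 + 1 →
        ∀ i, 2 ≤ i → i < n → (lineRestr f v u).coeff i = 0) := by
    intro v hv u hu hli hD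
    obtain ⟨e1, he1, h12⟩ := exists_linearIndependent_pair hr.1 hu
      (fun h => hD (by rw [h, map_zero]))
    exact card_transversals_aux hf hn hℓ hr hskew he1 hu h12 he3 hv hli hD F hF'
  obtain ⟨e4, he4, h34⟩ := exists_linearIndependent_pair hℓ.1 he3 he30
  obtain ⟨e2, he2, hD⟩ := not_grad_zero_of_skew hf hr.1 hℓ (by rw [inf_comm]; exact hskew)
    he3 he30
  refine ⟨(hmain e4 he4 e2 he2 h34 hD).1, fun hcard v hv u hu => ?_⟩
  have hmid : ∀ i, 2 ≤ i → i < n → (lineRestr f v u).coeff i = 0 := by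
    intro i hi2 hin
    let P : Polynomial k := (lineRestr f
      (fun j => Polynomial.C (v j) + Polynomial.X * Polynomial.C (e4 j))
      (fun j => Polynomial.C (u j) + Polynomial.X * Polynomial.C (e2 j))).coeff i
    have hPe : ∀ t, P.eval t = (lineRestr f (v + t • e4) (u + t • e2)).coeff i := by
      intro t
      rw [eval_coeff_lineRestr]
      congr 2 <;>
      · funext j
        simp only [Polynomial.eval_add, Polynomial.eval_C, Polynomial.eval_mul, Polynomial.eval_X,
          Pi.add_apply, Pi.smul_apply, smul_eq_mul]
    obtain ⟨s, t, hst⟩ := mem_span_of_linearIndependent_pair hℓ.1 h34 he3 he4 hv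
    have hP : P = 0 := by
      apply Polynomial.eq_zero_of_infinite_isRoot
      refine Set.Infinite.mono ?_
        ((Set.toFinite {-t, -(grad f e3 u / grad f e3 e2)}).infinite_compl)
      intro x hx
      simp only [Set.mem_compl_iff, Set.mem_insert_iff, Set.mem_singleton_iff, not_or] at hx
      change P.eval x = 0
      rw [hPe]
      refine (hmain _ (ℓ.add_mem hv (ℓ.smul_mem _ he4)) _ (r.add_mem hu (r.smul_mem _ he2))
        ?_ ?_).2 hcard i hi2 hin
      · rw [LinearIndependent.pair_iff] at h34 ⊢
        intro a b hab
        have h := h34 (a + b * s) (b * (t + x)) (by rw [← hab, ← hst]; module)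
        have hb : b = 0 := (mul_eq_zero.mp h.2).resolve_right
          (fun h' => hx.1 (by linear_combination h'))
        refine ⟨?_, hb⟩
        simpa [hb] using h.1
      · rw [map_add, map_smul, smul_eq_mul]
        intro h
        apply hx.2
        field_simp
        linear_combination h
    have := hPe 0
    rw [hP] at this
    simpa using this.symm
  have h1 := eval_lineRestr' f v u 1
  rw [one_smul, Polynomial.eval_eq_sum_range'
    (Nat.lt_succ_of_le (natDegree_lineRestr_le hf.2.1 v u))] at h1
  rw [← h1, ← coeff_one_lineRestr_grad, ← coeff_one_lineRestr_grad,
    ← coeff_lineRestr_symm hf.2.1 v u (rfl : n + 1 = n + 1)]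
  simp only [one_pow, mul_one]
  rw [← Finset.sum_pair (f := (lineRestr f v u).coeff) (by omega : 1 ≠ n)]
  symm
  apply Finset.sum_subset
  · intro i hi
    simp only [Finset.mem_insert, Finset.mem_singleton] at hi
    rw [Finset.mem_range]
    omega
  · intro i hi hi'
    simp only [Finset.mem_insert, Finset.mem_singleton, not_or] at hi'
    rw [Finset.mem_range] at hi
    rcases Nat.lt_or_ge i 2 with h2 | h2
    · obtain rfl : i = 0 := by omega
      rw [Polynomial.coeff_zero_eq_eval_zero, eval_lineRestr', zero_smul, add_zero]
      exact hℓ.2 v hv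
    · rcases Nat.lt_or_ge i n with h3 | h3
      · exact hmid i h2 h3
      · obtain rfl : i = n + 1 := by omega
        rw [coeff_natDegree_lineRestr hf.2.1]
        exact hr.2 u hu

end Transversals

section Counting

variable {α : Type*} [DecidableEq α] {L : Finset α} {adj : α → α → Prop} [DecidableRel adj] {n : ℕ}

theorem card_adj_add_card_not_adj (hirr : ∀ x, ¬ adj x x) {x : α} (hx : x ∈ L) :
    (L.filter (adj x)).card + (L.filter fun r => r ≠ x ∧ ¬ adj x r).card + 1 = L.card := by
  rw [← Finset.card_filter_add_card_filter_not (s := L) (adj x), add_assoc]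
  congr 1
  have h : L.filter (fun r => ¬ adj x r) =
      insert x (L.filter fun r => r ≠ x ∧ ¬ adj x r) := by
    ext r
    simp only [Finset.mem_filter, Finset.mem_insert]
    constructor
    · rintro ⟨h1, h2⟩
      by_cases h : r = x
      · exact Or.inl h
      · exact Or.inr ⟨h1, h, h2⟩
    · rintro (rfl | ⟨h1, -, h2⟩)
      · exact ⟨hx, hirr r⟩
      · exact ⟨h1, h2⟩
  rw [h, Finset.card_insert_of_notMem (by simp)]

theorem extremal_counting (hn : 1 ≤ n)
    (hirr : ∀ x, ¬ adj x x) (hL : L.card = n ^ 4 + n ^ 3 + n + 1)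
    (hskew : ∀ x ∈ L, (L.filter fun r => r ≠ x ∧ ¬ adj x r).card ≤ n ^ 4)
    (htrans : ∀ x ∈ L, ∀ r ∈ L, r ≠ x → ¬ adj x r →
      (L.filter fun m => adj x m ∧ adj m r).card ≤ n ^ 2 + 1)
    (hplane : ∀ x ∈ L, ∀ m ∈ L, adj x m →
      (L.filter fun r => adj m r ∧ (r = x ∨ adj x r)).card ≤ n) {x : α} (hx : x ∈ L) :
    (L.filter (adj x)).card = n ^ 3 + n ∧
    (L.filter fun r => r ≠ x ∧ ¬ adj x r).card = n ^ 4 ∧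
    (∀ r ∈ L, r ≠ x → ¬ adj x r →
      (L.filter fun m => adj x m ∧ adj m r).card = n ^ 2 + 1) ∧
    ∀ m ∈ L, adj x m → (L.filter fun r => (r ≠ x ∧ ¬ adj x r) ∧ adj m r).card = n ^ 3 := by
  have hdeg : ∀ m ∈ L, n ^ 3 + n ≤ (L.filter (adj m)).card := by
    intro m hm
    have h1 := card_adj_add_card_not_adj hirr hm
    have h2 := hskew m hm
    omega
  have hA : ∀ m ∈ L.filter (adj x),
      n ^ 3 ≤ (((L.filter fun r => r ≠ x ∧ ¬ adj x r)).filter (adj m)).card := by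
    intro m hm
    obtain ⟨hmL, hm⟩ := Finset.mem_filter.mp hm
    have h1 := hdeg m hmL
    have h2 := hplane x hx m hmL hm
    rw [← Finset.card_filter_add_card_filter_not (s := L.filter (adj m))
      (fun r => r = x ∨ adj x r), Finset.filter_filter, Finset.filter_filter] at h1
    rw [Finset.filter_filter]
    have h3 : L.filter (fun r => adj m r ∧ ¬ (r = x ∨ adj x r)) =
        L.filter fun r => (r ≠ x ∧ ¬ adj x r) ∧ adj m r := by
      ext r
      simp only [Finset.mem_filter, not_or]
      tauto
    rw [h3] at h1
    omega
  have hC : ∀ r ∈ L.filter (fun r => r ≠ x ∧ ¬ adj x r),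
      ((L.filter (adj x)).filter fun m => adj m r).card ≤ n ^ 2 + 1 := by
    intro r hr
    obtain ⟨hrL, hr1, hr2⟩ := Finset.mem_filter.mp hr
    rw [Finset.filter_filter]
    exact htrans x hx r hrL hr1 hr2
  have hdc : ∑ m ∈ L.filter (adj x), ((L.filter fun r => r ≠ x ∧ ¬ adj x r).filter (adj m)).card =
      ∑ r ∈ L.filter (fun r => r ≠ x ∧ ¬ adj x r),
        ((L.filter (adj x)).filter fun m => adj m r).card :=
    Finset.sum_card_bipartiteAbove_eq_sum_card_bipartiteBelow adj
  have h1 := Finset.sum_le_sum hA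
  have h2 := Finset.sum_le_sum hC
  rw [Finset.sum_const, smul_eq_mul] at h1 h2
  have h3 := card_adj_add_card_not_adj hirr hx
  have h4 := hskew x hx
  rw [hL] at h3
  have hM : (L.filter fun r => r ≠ x ∧ ¬ adj x r).card = n ^ 4 := by
    set M := (L.filter fun r => r ≠ x ∧ ¬ adj x r).card
    set N := (L.filter (adj x)).card
    obtain ⟨y, hy⟩ := Nat.exists_eq_add_of_le h4
    have hN : N = n ^ 3 + n + y := by omega
    have h5 : N * n ^ 3 ≤ M * (n ^ 2 + 1) := h1.trans (hdc.le.trans h2)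
    rw [hN] at h5
    have h6 : M * (n ^ 2 + 1) + y * (n ^ 2 + 1) = n ^ 4 * (n ^ 2 + 1) := by rw [hy]; ring
    have h7 : y * (n ^ 3 + n ^ 2 + 1) ≤ 0 := by
      have : (n ^ 3 + n + y) * n ^ 3 = n ^ 4 * (n ^ 2 + 1) + y * n ^ 3 := by ring
      have : y * (n ^ 3 + n ^ 2 + 1) = y * n ^ 3 + y * (n ^ 2 + 1) := by ring
      omega
    have h8 : y = 0 := by
      by_contra h
      have : 0 < y * (n ^ 3 + n ^ 2 + 1) := by positivity
      omega
    omega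
  have hN : (L.filter (adj x)).card = n ^ 3 + n := by omega
  have h5 : (n ^ 3 + n) * n ^ 3 = n ^ 4 * (n ^ 2 + 1) := by ring
  rw [hN] at h1
  rw [hM] at h2
  refine ⟨hN, hM, ?_, ?_⟩
  · intro r hr hr1 hr2
    have := (Finset.sum_eq_sum_iff_of_le hC).mp (by
      rw [Finset.sum_const, smul_eq_mul, hM]
      omega) r (Finset.mem_filter.mpr ⟨hr, hr1, hr2⟩)
    rwa [Finset.filter_filter] at this
  · intro m hm hxm
    have := (Finset.sum_eq_sum_iff_of_le hA).mp (by
      rw [Finset.sum_const, smul_eq_mul, hN]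
      omega) m (Finset.mem_filter.mpr ⟨hm, hxm⟩)
    rw [this, Finset.filter_filter]

theorem extremal_plane_count {x m : α}
    (hdeg : (L.filter (adj m)).card = n ^ 3 + n)
    (hskew : (L.filter fun r => (r ≠ x ∧ ¬ adj x r) ∧ adj m r).card = n ^ 3) :
    (L.filter fun r => adj m r ∧ (r = x ∨ adj x r)).card = n := by
  rw [← Finset.card_filter_add_card_filter_not (s := L.filter (adj m))
      (fun r => r = x ∨ adj x r), Finset.filter_filter, Finset.filter_filter] at hdeg
  have h3 : L.filter (fun r => adj m r ∧ ¬ (r = x ∨ adj x r)) =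
      L.filter fun r => (r ≠ x ∧ ¬ adj x r) ∧ adj m r := by
    ext r
    simp only [Finset.mem_filter, not_or]
    tauto
  rw [h3] at hdeg
  omega

end Counting

section StarChord

theorem isPrimePow_of_choose_eq_zero {k : Type*} [Field k] {n : ℕ} (hn : 2 ≤ n)
    (h : ∀ i, 0 < i → i < n → (n.choose i : k) = 0) : IsPrimePow n := by
  obtain ⟨p, hp⟩ := CharP.exists k
  have hn0 : (n : k) = 0 := by simpa using h 1 one_pos (by omega)
  have hpn : p ∣ n := (CharP.cast_eq_zero_iff k p n).mp hn0
  have hp0 : p ≠ 0 := by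
    rintro rfl
    have := Nat.eq_zero_of_zero_dvd hpn
    omega
  have hpp : p.Prime := (CharP.char_is_prime_or_zero k p).resolve_right hp0
  have : Fact p.Prime := ⟨hpp⟩
  obtain ⟨e, m, hm, rfl⟩ := Nat.exists_eq_pow_mul_and_not_dvd (n := n) (by omega) p hpp.ne_one
  have he : e ≠ 0 := by
    rintro rfl
    exact hm (by simpa using hpn)
  have hmk : (m : k) ≠ 0 := fun h => hm ((CharP.cast_eq_zero_iff k p m).mp h)
  have hpe : 0 < p ^ e := pow_pos hpp.pos e
  have hchoose : ((p ^ e * m).choose (p ^ e) : k) = m := by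
    rw [← Polynomial.coeff_X_add_one_pow, pow_mul, add_pow_char_pow, one_pow]
    have h1 : (Polynomial.X ^ p ^ e + 1 : Polynomial k) ^ m =
        Polynomial.expand k (p ^ e) ((Polynomial.X + 1) ^ m) := by
      simp
    have h2 := Polynomial.coeff_expand_mul hpe ((Polynomial.X + 1 : Polynomial k) ^ m) 1
    rw [one_mul] at h2
    rw [h1, h2, Polynomial.coeff_X_add_one_pow, Nat.choose_one_right]
  have hm1 : m = 1 := by
    by_contra hm1
    have hm0 : m ≠ 0 := by
      rintro rfl
      exact hm (dvd_zero p)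
    refine hmk (hchoose ▸ h (p ^ e) hpe ?_)
    exact lt_mul_of_one_lt_right hpe (by omega)
  rw [hm1, mul_one]
  exact hpp.isPrimePow.pow he

variable {k : Type*} [Field k]

theorem isPrimePow_of_binomial [Infinite k] {n : ℕ} (hn : 2 ≤ n) {a b c α : k} (hα : α ≠ 0)
    (hc : c ≠ 0) (h : ∀ w : k, α * (w + c) ^ n = a * w ^ n + b) : IsPrimePow n := by
  apply isPrimePow_of_choose_eq_zero (k := k) hn
  intro i hi hin
  have hpoly : Polynomial.C α * (Polynomial.X + Polynomial.C c) ^ n =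
      Polynomial.C a * Polynomial.X ^ n + Polynomial.C b := by
    apply Polynomial.funext
    intro w
    simpa using h w
  have hcoeff := congrArg (Polynomial.coeff · i) hpoly
  simp only [Polynomial.coeff_C_mul, Polynomial.coeff_X_add_C_pow, Polynomial.coeff_add,
    Polynomial.coeff_X_pow, Polynomial.coeff_C_of_ne_zero hi.ne', hin.ne, if_false, mul_zero,
    add_zero] at hcoeff
  simpa [hα, hc] using hcoeff

theorem exists_prod_eq_add_pow [IsAlgClosed k] {V : Type*} [AddCommGroup V] [Module k V] {α : k}
    (hα : α ≠ 0) (δ : k) {N : ℕ} (hN : 0 < N) (x w : Module.Dual k V) :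
    ∃ h : Fin N → Module.Dual k V, ∀ v, α * w v ^ N + δ * x v ^ N = ∏ i, h i v := by
  obtain ⟨a, rfl⟩ := IsAlgClosed.exists_pow_nat_eq α hN
  set p : Polynomial k := Polynomial.X ^ N + Polynomial.C (δ / a ^ N) with hp
  have hmonic : p.Monic := Polynomial.monic_X_pow_add_C _ hN.ne'
  have hsplit : p.Splits := IsAlgClosed.splits p
  have hroots := hsplit.eq_prod_roots_of_monic hmonic
  have hlen : p.roots.toList.length = N := by
    rw [Multiset.length_toList, ← hsplit.natDegree_eq_card_roots, hp,
      Polynomial.natDegree_X_pow_add_C]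
  refine ⟨fun i => a • (w - p.roots.toList[Fin.cast hlen.symm i] • x), fun v => ?_⟩
  have h1 : ∏ i : Fin N, (a • (w - p.roots.toList[Fin.cast hlen.symm i] • x)) v =
      (p.roots.map fun t => a * (w v - t * x v)).prod := by
    rw [← Fin.prod_congr' _ hlen]
    simp only [Fin.cast_cast, Fin.cast_eq_self, LinearMap.smul_apply, LinearMap.sub_apply,
      smul_eq_mul]
    refine (Fin.prod_univ_fun_getElem p.roots.toList (fun t => a * (w v - t * x v))).trans ?_
    rw [← Multiset.prod_coe, ← Multiset.map_coe, Multiset.coe_toList]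
  have hcard : Multiset.card p.roots = N := by rw [← Multiset.length_toList, hlen]
  have heval : ∀ y : k, (p.roots.map fun t => y - t).prod = y ^ N + δ / a ^ N := by
    intro y
    have := congrArg (Polynomial.eval y) hroots
    rw [Polynomial.eval_multiset_prod, Multiset.map_map] at this
    simpa [hp] using this.symm
  have ha : a ^ N ≠ 0 := hα
  rw [h1, Multiset.prod_map_mul, Multiset.map_const', Multiset.prod_replicate, hcard]
  by_cases hx : x v = 0
  · simp [hx, hcard, hN.ne']
  · have h2 : (p.roots.map fun t => w v - t * x v).prod =
        (p.roots.map fun t => x v * (w v / x v - t)).prod := by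
      congr 1
      apply Multiset.map_congr rfl
      intro t _
      field_simp
    rw [h2, Multiset.prod_map_mul, Multiset.map_const', Multiset.prod_replicate, hcard, heval, div_pow]
    field_simp

theorem exists_common_zero (h : Fin 3 → Module.Dual k (Fin 4 → k)) :
    ∃ v ≠ 0, ∀ i, h i v = 0 := by
  have := LinearMap.ker_ne_bot_of_finrank_lt (f := LinearMap.pi h) (by simp)
  obtain ⟨v, hv, hv0⟩ := Submodule.exists_mem_ne_zero_of_ne_bot this
  exact ⟨v, hv0, fun i => congrFun hv i⟩

theorem coeff_one_prod_eq_zero {d : ℕ} (h : Fin d → Module.Dual k (Fin 4 → k)) {i m : Fin d}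
    (him : i ≠ m) {v : Fin 4 → k} (hi : h i v = 0) (hm : h m v = 0) (u : Fin 4 → k) :
    (∏ j, (Polynomial.C (h j v) + Polynomial.X * Polynomial.C (h j u))).coeff 1 = 0 := by
  rw [← Finset.mul_prod_erase _ _ (Finset.mem_univ i),
    ← Finset.mul_prod_erase _ _ (Finset.mem_erase.mpr ⟨him.symm, Finset.mem_univ m⟩), hi, hm,
    map_zero, zero_add, zero_add, mul_assoc]
  simp

theorem eq_zero_of_two_two [Infinite k] {f : MvPolynomial (Fin 4) k} {d : ℕ}
    (hf : IsSmoothSurface f d) {h g : Fin d → Module.Dual k (Fin 4 → k)}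
    (hfg : ∀ v, eval v f = ∏ i, h i v + ∏ j, g j v) {i m j l : Fin d} (him : i ≠ m) (hjl : j ≠ l)
    {v : Fin 4 → k} (hi : h i v = 0) (hm : h m v = 0) (hj : g j v = 0) (hl : g l v = 0) :
    v = 0 := by
  by_contra hv
  refine hf.grad_ne_zero hv ?_ ?_
  · rw [hfg, Finset.prod_eq_zero (Finset.mem_univ i) hi,
      Finset.prod_eq_zero (Finset.mem_univ j) hj, add_zero]
  · refine LinearMap.ext fun u => ?_
    have hpoly : lineRestr f v u =
        ∏ j, (Polynomial.C (h j v) + Polynomial.X * Polynomial.C (h j u)) +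
        ∏ j, (Polynomial.C (g j v) + Polynomial.X * Polynomial.C (g j u)) := by
      apply Polynomial.funext
      intro t
      rw [eval_lineRestr', hfg, Polynomial.eval_add, Polynomial.eval_prod, Polynomial.eval_prod]
      simp only [map_add, map_smul, smul_eq_mul, Polynomial.eval_add, Polynomial.eval_mul,
        Polynomial.eval_C, Polynomial.eval_X]
    rw [← coeff_one_lineRestr_grad, hpoly, Polynomial.coeff_add, coeff_one_prod_eq_zero h him hi hm,
      coeff_one_prod_eq_zero g hjl hj hl, add_zero, LinearMap.zero_apply]

theorem isNSCPairConfig_of_eval_eq [Infinite k] {f : MvPolynomial (Fin 4) k} {d : ℕ} (hd : 2 ≤ d)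
    (hf : IsSmoothSurface f d) {h g : Fin d → Module.Dual k (Fin 4 → k)}
    (hfg : ∀ v, eval v f = ∏ i, h i v + ∏ j, g j v) :
    IsNSCPairConfig f (fun i => LinearMap.ker (h i)) (fun j => LinearMap.ker (g j)) := by
  have key := fun {i m j l : Fin d} him hjl {v} hi hm hj hl =>
    eq_zero_of_two_two hf hfg (i := i) (m := m) (j := j) (l := l) him hjl (v := v) hi hm hj hl
  have : Nontrivial (Fin d) := Fin.nontrivial_iff_two_le.mpr hd
  have hz : ∀ a b c : Module.Dual k (Fin 4 → k), ∃ v ≠ 0, a v = 0 ∧ b v = 0 ∧ c v = 0 := by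
    intro a b c
    obtain ⟨v, hv, h⟩ := exists_common_zero ![a, b, c]
    exact ⟨v, hv, h 0, h 1, h 2⟩
  have hhh : ∀ i m, i ≠ m → ¬ LinearMap.ker (h i) ≤ LinearMap.ker (h m) := by
    intro i m him hle
    obtain ⟨j, l, hjl⟩ := exists_pair_ne (Fin d)
    obtain ⟨v, hv, h1, h2, h3⟩ := hz (h i) (g j) (g l)
    exact hv (key him hjl h1 (hle h1) h2 h3)
  have hgg : ∀ j l, j ≠ l → ¬ LinearMap.ker (g j) ≤ LinearMap.ker (g l) := by
    intro j l hjl hle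
    obtain ⟨i, m, him⟩ := exists_pair_ne (Fin d)
    obtain ⟨v, hv, h1, h2, h3⟩ := hz (h i) (h m) (g j)
    exact hv (key him hjl h1 h2 h3 (hle h3))
  have hne0 : ∀ a b : Module.Dual k (Fin 4 → k), ¬ LinearMap.ker a ≤ LinearMap.ker b →
      Module.finrank k (LinearMap.ker b) = 3 := by
    intro a b hab
    have hb : b ≠ 0 := by
      rintro rfl
      exact hab (by simp)
    have h1 := LinearMap.finrank_range_add_finrank_ker b
    rw [LinearMap.range_eq_top.mpr (LinearMap.surjective hb)] at h1
    simp at h1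
    omega
  have hH : ∀ i, Module.finrank k (LinearMap.ker (h i)) = 3 := fun i => by
    obtain ⟨m, hm⟩ := exists_ne i
    exact hne0 _ _ (hhh m i hm)
  have hK : ∀ i, Module.finrank k (LinearMap.ker (g i)) = 3 := fun i => by
    obtain ⟨m, hm⟩ := exists_ne i
    exact hne0 _ _ (hgg m i hm)
  have hHK : ∀ i j, LinearMap.ker (h i) ≠ LinearMap.ker (g j) := by
    intro i j hij
    obtain ⟨m, hm⟩ := exists_ne i
    obtain ⟨l, hl⟩ := exists_ne j
    obtain ⟨v, hv, h1, h2, h3⟩ := hz (h i) (h m) (g l)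
    refine hv (key hm hl h2 h1 h3 ?_)
    exact hij.le h1
  refine ⟨hH, hK, ?_, ?_, hHK, ?_, ?_⟩
  · intro i m him
    by_contra hne
    exact hhh i m hne him.le
  · intro i m him
    by_contra hne
    exact hgg i m hne him.le
  · intro i j m l heq
    constructor
    · by_contra him
      obtain ⟨j', hj'⟩ := exists_ne j
      obtain ⟨v, hv, h1, h2, h3⟩ := hz (h i) (g j) (g j')
      exact hv (key him hj'.symm h1 (heq.le ⟨h1, h2⟩).1 h2 h3)
    · by_contra hjl
      obtain ⟨i', hi'⟩ := exists_ne i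
      obtain ⟨v, hv, h1, h2, h3⟩ := hz (h i) (h i') (g j)
      exact hv (key hi'.symm hjl h1 h2 h3 (heq.le ⟨h1, h3⟩).2)
  · intro i j
    constructor
    · have h1 := Submodule.finrank_sup_add_finrank_inf_eq (LinearMap.ker (h i))
        (LinearMap.ker (g j))
      have h2 : Module.finrank k (LinearMap.ker (h i) ⊔ LinearMap.ker (g j) :
          Submodule k (Fin 4 → k)) ≤ 4 := by
        simpa using Submodule.finrank_le (LinearMap.ker (h i) ⊔ LinearMap.ker (g j))
      have h3 : Module.finrank k (LinearMap.ker (h i)) < Module.finrank k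
          (LinearMap.ker (h i) ⊔ LinearMap.ker (g j) : Submodule k (Fin 4 → k)) := by
        apply Submodule.finrank_lt_finrank_of_lt
        refine lt_of_le_of_ne le_sup_left fun heq => hHK i j ?_
        symm
        apply Submodule.eq_of_le_of_finrank_le
        · rw [heq]
          exact le_sup_right
        · rw [hH, hK]
      rw [hH, hK] at h1
      rw [hH] at h3
      change Module.finrank k (LinearMap.ker (h i) ⊓ LinearMap.ker (g j) :
        Submodule k (Fin 4 → k)) = 2
      omega
    · intro v hv
      rw [hfg, Finset.prod_eq_zero (Finset.mem_univ i) (LinearMap.mem_ker.mp hv.1),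
        Finset.prod_eq_zero (Finset.mem_univ j) (LinearMap.mem_ker.mp hv.2), add_zero]

end StarChord

section Extremal

variable {k : Type*} [Field k] {f : MvPolynomial (Fin 4) k} {n : ℕ}

theorem IsSmoothSurface.grad_smul (hf : IsSmoothSurface f (n + 1)) (t : k) (v u : Fin 4 → k) :
    grad f (t • v) u = t ^ n * grad f v u := by
  have h := isHomogeneous_dirDeriv hf.2.1 u
  rw [Nat.add_sub_cancel] at h
  exact eval_smul_of_isHomogeneous h t v

/-- Only the two extreme mixed terms of `f` survive on `ℓ ⊔ r`. -/
def SplitsAlong (f : MvPolynomial (Fin 4) k) (ℓ r : Submodule k (Fin 4 → k)) : Prop :=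
  ∀ v ∈ ℓ, ∀ u ∈ r, eval (v + u) f = grad f v u + grad f u v

theorem SplitsAlong.symm {ℓ r : Submodule k (Fin 4 → k)} (h : SplitsAlong f ℓ r) :
    SplitsAlong f r ℓ := fun v hv u hu => by
  rw [add_comm, h u hu v hv, add_comm]

theorem SplitsAlong.grad_eq (hf : IsSmoothSurface f (n + 1)) (hn : 1 ≤ n)
    {ℓ r m' : Submodule k (Fin 4 → k)} (h : SplitsAlong f ℓ r) (hm' : IsLineOn f m')
    {e v : Fin 4 → k} (her : e ∈ r) (hv : v ∈ ℓ) {c : k} (hc : c ≠ 0) (hvc : v + c • e ∈ m') :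
    grad f v e = -(c ^ (n - 1) * grad f e v) := by
  have h1 := h v hv (c • e) (r.smul_mem c her)
  rw [hm'.2 _ hvc, hf.grad_smul, map_smul, smul_eq_mul] at h1
  obtain ⟨n, rfl⟩ := Nat.exists_eq_add_of_le' hn
  rw [Nat.add_sub_cancel]
  apply mul_left_cancel₀ hc
  linear_combination -h1

theorem eq_of_finrank_le_one {P Q : Submodule k (Fin 4 → k)} (hP : Module.finrank k P ≤ 1)
    (hQ : Module.finrank k Q ≤ 1) {x : Fin 4 → k} (hx : x ≠ 0) (hxP : x ∈ P) (hxQ : x ∈ Q) :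
    P = Q := by
  have h : ∀ P : Submodule k (Fin 4 → k), Module.finrank k P ≤ 1 → x ∈ P →
      Submodule.span k {x} = P := by
    intro P hP hxP
    apply Submodule.eq_of_le_of_finrank_le
    · simpa using hxP
    · rwa [finrank_span_singleton hx]
  rw [← h P hP hxP, h Q hQ hxQ]

variable [IsAlgClosed k]

/-- Consequences of `S` having the maximal number of lines: every line has a skew line, two skew
lines have `n ^ 2 + 1` transversals, and for two meeting lines the plane they span contains `n`
lines other than the second one, while some line meets the second one and misses the first. -/
theorem extremal_lines (hf : IsSmoothSurface f (n + 1)) (hn : 2 ≤ n)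
    (hcount : {W : Submodule k (Fin 4 → k) | IsLineOn f W}.ncard = n ^ 4 + n ^ 3 + n + 1) :
    (∀ ℓ, IsLineOn f ℓ → ∃ r, IsLineOn f r ∧ ℓ ⊓ r = ⊥) ∧
    (∀ ℓ r, IsLineOn f ℓ → IsLineOn f r → ℓ ⊓ r = ⊥ →
      ∃ F : Finset (Submodule k (Fin 4 → k)), F.card = n ^ 2 + 1 ∧
        ∀ m ∈ F, IsLineOn f m ∧ m ⊓ ℓ ≠ ⊥ ∧ m ⊓ r ≠ ⊥) ∧
    (∀ ℓ m, IsLineOn f ℓ → IsLineOn f m → ℓ ≠ m → ℓ ⊓ m ≠ ⊥ →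
      (∃ F : Finset (Submodule k (Fin 4 → k)), F.card = n ∧
        ∀ r ∈ F, IsLineOn f r ∧ r ≠ m ∧ r ≤ ℓ ⊔ m) ∧
      ∃ r, IsLineOn f r ∧ r ⊓ m ≠ ⊥ ∧ ℓ ⊓ r = ⊥) := by
  classical
  have hfin : {W : Submodule k (Fin 4 → k) | IsLineOn f W}.Finite :=
    Set.finite_of_ncard_ne_zero (by omega)
  set L := hfin.toFinset with hLdef
  have hmem : ∀ W, W ∈ L ↔ IsLineOn f W := fun W => by simp [L]
  have hL : L.card = n ^ 4 + n ^ 3 + n + 1 := by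
    rw [← hcount, Set.ncard_eq_toFinset_card _ hfin]
  let adj : Submodule k (Fin 4 → k) → Submodule k (Fin 4 → k) → Prop :=
    fun x y => x ≠ y ∧ x ⊓ y ≠ ⊥
  have hnadj : ∀ x r, r ≠ x → ¬ adj x r → x ⊓ r = ⊥ := fun x r hne h => by
    by_contra hcon
    exact h ⟨hne.symm, hcon⟩
  have hskewadj : ∀ x r, IsLineOn f x → x ⊓ r = ⊥ → r ≠ x ∧ ¬ adj x r := by
    intro x r hx h
    refine ⟨?_, fun h' => h'.2 h⟩
    rintro rfl
    rw [inf_idem] at h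
    have := hx.1
    rw [h, finrank_bot] at this
    omega
  have hplane : ∀ x ∈ L, ∀ m ∈ L, adj x m → ∀ r ∈ L.filter
      (fun r => adj m r ∧ (r = x ∨ adj x r)), IsLineOn f r ∧ r ≠ m ∧ r ≤ x ⊔ m := by
    intro x hx m hm hxm r hr
    obtain ⟨hrL, hmr, hrx⟩ := Finset.mem_filter.mp hr
    rw [hmem] at hx hm hrL
    refine ⟨hrL, hmr.1.symm, ?_⟩
    rcases hrx with rfl | hrx
    · exact le_sup_left
    · exact le_plane_of_triangle hf hx hm hrL hxm.1 hxm.2 (by rw [inf_comm]; exact hrx.2)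
        (by rw [inf_comm]; exact hmr.2)
  have htr : ∀ x r, ∀ m ∈ L.filter (fun m => adj x m ∧ adj m r),
      IsLineOn f m ∧ m ⊓ x ≠ ⊥ ∧ m ⊓ r ≠ ⊥ := by
    intro x r m hm
    obtain ⟨hmL, h1, h2⟩ := Finset.mem_filter.mp hm
    exact ⟨(hmem m).mp hmL, by rw [inf_comm]; exact h1.2, h2.2⟩
  have hext := fun x (hx : x ∈ L) => extremal_counting (L := L) (adj := adj) (n := n) (by omega)
    (fun x h => h.1 rfl) hL
    (by
      intro x hx
      refine card_skew_le hf hn ((hmem x).mp hx) _ fun m hm => ?_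
      obtain ⟨hmL, h1, h2⟩ := Finset.mem_filter.mp hm
      exact ⟨(hmem m).mp hmL, hnadj x m h1 h2⟩)
    (by
      intro x hx r hr h1 h2
      exact (card_transversals hf hn ((hmem x).mp hx) ((hmem r).mp hr) (hnadj x r h1 h2) _
        (htr x r)).1)
    (by
      intro x hx m hm hxm
      have h3 := finrank_sup_eq_three ((hmem x).mp hx).1 ((hmem m).mp hm).1 hxm.1 hxm.2
      have h4 := card_lines_in_plane_le hf (by omega) h3
        (insert m (L.filter fun r => adj m r ∧ (r = x ∨ adj x r))) (by
          intro r hr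
          rcases Finset.mem_insert.mp hr with rfl | hr
          · exact ⟨(hmem r).mp hm, le_sup_right⟩
          · have := hplane x hx m hm hxm r hr
            exact ⟨this.1, this.2.2⟩)
      rw [Finset.card_insert_of_notMem (by simp [adj])] at h4
      omega) hx
  refine ⟨?_, ?_, ?_⟩
  · intro ℓ hℓ
    have h := (hext ℓ ((hmem ℓ).mpr hℓ)).2.1
    have hpos : 0 < (L.filter fun r => r ≠ ℓ ∧ ¬ adj ℓ r).card := by rw [h]; positivity
    obtain ⟨r, hr⟩ := Finset.card_pos.mp hpos
    obtain ⟨hrL, h1, h2⟩ := Finset.mem_filter.mp hr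
    exact ⟨r, (hmem r).mp hrL, hnadj ℓ r h1 h2⟩
  · intro ℓ r hℓ hr hskew
    obtain ⟨h1, h2⟩ := hskewadj ℓ r hℓ hskew
    exact ⟨_, (hext ℓ ((hmem ℓ).mpr hℓ)).2.2.1 r ((hmem r).mpr hr) h1 h2, htr ℓ r⟩
  · intro ℓ m hℓ hm hne hmeet
    have hA := (hext ℓ ((hmem ℓ).mpr hℓ)).2.2.2 m ((hmem m).mpr hm) ⟨hne, hmeet⟩
    refine ⟨⟨_, extremal_plane_count (hext m ((hmem m).mpr hm)).1 hA,
      hplane ℓ ((hmem ℓ).mpr hℓ) m ((hmem m).mpr hm) ⟨hne, hmeet⟩⟩, ?_⟩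
    have hpos : 0 < (L.filter fun r => (r ≠ ℓ ∧ ¬ adj ℓ r) ∧ adj m r).card := by
      rw [hA]
      positivity
    obtain ⟨r, hr⟩ := Finset.card_pos.mp hpos
    obtain ⟨hrL, ⟨h1, h2⟩, h3⟩ := Finset.mem_filter.mp hr
    exact ⟨r, (hmem r).mp hrL, by rw [inf_comm]; exact h3.2, hnadj ℓ r h1 h2⟩

/-- If `r` meets the line `m` at `e` and is skew to `ℓ`, then `e` lies on no other line of the
plane `ℓ ⊔ m`. -/
theorem not_mem_third_line (hf : IsSmoothSurface f (n + 1)) {ℓ m r m' : Submodule k (Fin 4 → k)}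
    (hℓ : IsLineOn f ℓ) (hm : IsLineOn f m) (hr : IsLineOn f r) (hm' : IsLineOn f m')
    (hne : ℓ ≠ m) (hmeet : ℓ ⊓ m ≠ ⊥) (hskew : ℓ ⊓ r = ⊥) (hm'm : m' ≠ m) (hle : m' ≤ ℓ ⊔ m)
    {e : Fin 4 → k} (he0 : e ≠ 0) (hem : e ∈ m) (her : e ∈ r) : e ∉ m' := by
  intro hem'
  have h3 := finrank_sup_eq_three hℓ.1 hm.1 hne hmeet
  have h4 : m' ⊔ m = ℓ ⊔ m := by
    apply Submodule.eq_of_le_of_finrank_le (sup_le hle le_sup_right)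
    rw [h3, finrank_sup_eq_three hm'.1 hm.1 hm'm]
    intro h
    have : e ∈ m' ⊓ m := ⟨hem', hem⟩
    rw [h] at this
    exact he0 this
  obtain ⟨u, hu, hne⟩ := not_grad_zero_of_skew hf hℓ.1 hr hskew her he0
  apply hne
  have : m' ⊔ m ≤ LinearMap.ker (grad f e) := sup_le (hm'.le_ker hem') (hm.le_ker hem)
  rw [h4] at this
  exact this (Submodule.mem_sup_left hu)

theorem exists_add_smul_mem (hf : IsSmoothSurface f (n + 1)) {ℓ m r m' : Submodule k (Fin 4 → k)}
    (hℓ : IsLineOn f ℓ) (hm : IsLineOn f m) (hr : IsLineOn f r) (hm' : IsLineOn f m')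
    (hne : ℓ ≠ m) (hmeet : ℓ ⊓ m ≠ ⊥) (hskew : ℓ ⊓ r = ⊥) (hm'm : m' ≠ m) (hle : m' ≤ ℓ ⊔ m)
    {e : Fin 4 → k} (he0 : e ≠ 0) (hem : e ∈ m) (her : e ∈ r) {v : Fin 4 → k} (hv : v ∈ ℓ) :
    ∃ c : k, v + c • e ∈ m' := by
  have hem' := not_mem_third_line hf hℓ hm hr hm' hne hmeet hskew hm'm hle he0 hem her
  have h1 : m' ⊔ Submodule.span k {e} = ℓ ⊔ m := by
    apply Submodule.eq_of_le_of_finrank_le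
    · exact sup_le hle (by simpa using Submodule.mem_sup_right hem)
    · rw [finrank_sup_span hem', hm'.1, finrank_sup_eq_three hℓ.1 hm.1 hne hmeet]
  have h2 : v ∈ m' ⊔ Submodule.span k {e} := h1 ▸ Submodule.mem_sup_left hv
  obtain ⟨x, hx, y, hy, rfl⟩ := Submodule.mem_sup.mp h2
  obtain ⟨c, rfl⟩ := Submodule.mem_span_singleton.mp hy
  exact ⟨-c, by simpa using hx⟩

theorem grad_eq_zero_of_concurrent {ℓ m m' : Submodule k (Fin 4 → k)} (hℓ : IsLineOn f ℓ)
    (hm : IsLineOn f m) (hm' : IsLineOn f m') (hne : ℓ ≠ m) (hmeet : ℓ ⊓ m ≠ ⊥) (hm'ℓ : m' ≠ ℓ) (hle : m' ≤ ℓ ⊔ m)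
    {e : Fin 4 → k} (hem : e ∈ m) {v : Fin 4 → k} (hv : v ∈ ℓ) (hv' : v ∈ m') :
    grad f v e = 0 := by
  by_cases hv0 : v = 0
  · rw [hv0]
    exact grad_eq_zero_of_mem hm.2 m.zero_mem hem
  have h1 : ℓ ⊔ m' = ℓ ⊔ m := by
    apply Submodule.eq_of_le_of_finrank_le (sup_le le_sup_left hle)
    rw [finrank_sup_eq_three hℓ.1 hm.1 hne hmeet, finrank_sup_eq_three hℓ.1 hm'.1 hm'ℓ.symm]
    intro h
    have : v ∈ ℓ ⊓ m' := ⟨hv, hv'⟩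
    rw [h] at this
    exact hv0 this
  have h2 : ℓ ⊔ m' ≤ LinearMap.ker (grad f v) := sup_le (hℓ.le_ker hv) (hm'.le_ker hv')
  rw [h1] at h2
  exact h2 (Submodule.mem_sup_right hem)

theorem inf_eq_inf_of_third_lines (hf : IsSmoothSurface f (n + 1)) (hn : 1 ≤ n)
    {ℓ m r m₁ m₂ : Submodule k (Fin 4 → k)} (hℓ : IsLineOn f ℓ) (hm : IsLineOn f m)
    (hr : IsLineOn f r) (hne : ℓ ≠ m) (hmeet : ℓ ⊓ m ≠ ⊥) (hskew : ℓ ⊓ r = ⊥) (hrm : r ⊓ m ≠ ⊥)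
    (hs : SplitsAlong f ℓ r) (h₁ : IsLineOn f m₁) (h₁ℓ : m₁ ≠ ℓ) (h₁m : m₁ ≠ m)
    (h₁le : m₁ ≤ ℓ ⊔ m) (h₂ : IsLineOn f m₂) (h₂ℓ : m₂ ≠ ℓ) (h₂m : m₂ ≠ m)
    (h₂le : m₂ ≤ ℓ ⊔ m) : m₁ ⊓ ℓ = m₂ ⊓ ℓ := by
  have h3 := finrank_sup_eq_three hℓ.1 hm.1 hne hmeet
  obtain ⟨e, ⟨her, hem⟩, he0⟩ := Submodule.exists_mem_ne_zero_of_ne_bot hrm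
  obtain ⟨x₁, ⟨hx₁, hx₁ℓ⟩, hx₁0⟩ := Submodule.exists_mem_ne_zero_of_ne_bot
    (inf_ne_bot_of_le_plane h₁.1 hℓ.1 h3 h₁le le_sup_left)
  obtain ⟨x₂, ⟨hx₂, hx₂ℓ⟩, hx₂0⟩ := Submodule.exists_mem_ne_zero_of_ne_bot
    (inf_ne_bot_of_le_plane h₂.1 hℓ.1 h3 h₂le le_sup_left)
  by_contra hcon
  have hx₁₂ : x₁ ∉ m₂ := fun h => hcon (eq_of_finrank_le_one (finrank_inf_le_one h₁.1 hℓ.1 h₁ℓ)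
    (finrank_inf_le_one h₂.1 hℓ.1 h₂ℓ) hx₁0 ⟨hx₁, hx₁ℓ⟩ ⟨h, hx₁ℓ⟩)
  have hx₂₁ : x₂ ∉ m₁ := fun h => hcon (eq_of_finrank_le_one (finrank_inf_le_one h₁.1 hℓ.1 h₁ℓ)
    (finrank_inf_le_one h₂.1 hℓ.1 h₂ℓ) hx₂0 ⟨h, hx₂ℓ⟩ ⟨hx₂, hx₂ℓ⟩)
  have key : ∀ {m₁ m₂ : Submodule k (Fin 4 → k)}, IsLineOn f m₁ → m₁ ≠ ℓ → m₁ ≤ ℓ ⊔ m →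
      IsLineOn f m₂ → m₂ ≠ m → m₂ ≤ ℓ ⊔ m → ∀ {x}, x ∈ m₁ → x ∈ ℓ → x ∉ m₂ →
      grad f e x = 0 := by
    intro m₁ m₂ h₁ h₁ℓ h₁le h₂ h₂m h₂le x hx hxℓ hx2
    obtain ⟨c, hc⟩ := exists_add_smul_mem hf hℓ hm hr h₂ hne hmeet hskew h₂m h₂le he0 hem her hxℓ
    have hc0 : c ≠ 0 := by
      rintro rfl
      exact hx2 (by simpa using hc)
    have h4 := hs.grad_eq hf hn h₂ her hxℓ hc0 hc
    rw [grad_eq_zero_of_concurrent hℓ hm h₁ hne hmeet h₁ℓ h₁le hem hxℓ hx, eq_comm,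
      neg_eq_zero] at h4
    exact (mul_eq_zero.mp h4).resolve_left (pow_ne_zero _ hc0)
  have hli : LinearIndependent k ![x₁, x₂] := by
    rw [LinearIndependent.pair_iff' hx₁0]
    rintro a rfl
    exact hx₂₁ (m₁.smul_mem a hx₁)
  obtain ⟨u, hu, hue⟩ := not_grad_zero_of_skew hf hℓ.1 hr hskew her he0
  obtain ⟨s, t, rfl⟩ := mem_span_of_linearIndependent_pair hℓ.1 hli hx₁ℓ hx₂ℓ hu
  apply hue
  rw [map_add, map_smul, map_smul, key h₁ h₁ℓ h₁le h₂ h₂m h₂le hx₁ hx₁ℓ hx₁₂,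
    key h₂ h₂ℓ h₂le h₁ h₁m h₁le hx₂ hx₂ℓ hx₂₁]
  simp

/-- The conditions on `S` forced by having the maximal number of lines. -/
structure IsExtremal (f : MvPolynomial (Fin 4) k) (n : ℕ) : Prop where
  smooth : IsSmoothSurface f (n + 1)
  two_le : 2 ≤ n
  splits : ∀ ℓ r, IsLineOn f ℓ → IsLineOn f r → ℓ ⊓ r = ⊥ → SplitsAlong f ℓ r
  plane : ∀ ℓ m, IsLineOn f ℓ → IsLineOn f m → ℓ ≠ m → ℓ ⊓ m ≠ ⊥ →
    ∃ F : Finset (Submodule k (Fin 4 → k)), F.card = n ∧ ∀ r ∈ F, IsLineOn f r ∧ r ≠ m ∧ r ≤ ℓ ⊔ m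
  skew : ∀ ℓ m, IsLineOn f ℓ → IsLineOn f m → ℓ ≠ m → ℓ ⊓ m ≠ ⊥ →
    ∃ r, IsLineOn f r ∧ r ⊓ m ≠ ⊥ ∧ ℓ ⊓ r = ⊥

theorem IsExtremal.exists_third_line (h : IsExtremal f n) {ℓ m : Submodule k (Fin 4 → k)}
    (hℓ : IsLineOn f ℓ) (hm : IsLineOn f m) (hne : ℓ ≠ m) (hmeet : ℓ ⊓ m ≠ ⊥) :
    ∃ m', IsLineOn f m' ∧ m' ≠ ℓ ∧ m' ≠ m ∧ m' ≤ ℓ ⊔ m ∧ (3 ≤ n → m' ⊓ ℓ = m ⊓ ℓ) := by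
  classical
  obtain ⟨F, hFcard, hF⟩ := h.plane ℓ m hℓ hm hne hmeet
  have h2 := h.two_le
  have hcard := Finset.pred_card_le_card_erase (s := F) (a := ℓ)
  rw [hFcard] at hcard
  obtain ⟨m₁, hm₁⟩ := Finset.card_pos.mp (show 0 < (F.erase ℓ).card by omega)
  obtain ⟨hm₁ℓ, hm₁F⟩ := Finset.mem_erase.mp hm₁
  obtain ⟨h₁, h₁m, h₁le⟩ := hF m₁ hm₁F
  by_cases hn : 3 ≤ n
  swap
  · exact ⟨m₁, h₁, hm₁ℓ, h₁m, h₁le, fun h => absurd h hn⟩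
  obtain ⟨m₂, hm₂, hne₂⟩ := Finset.exists_mem_ne (show 1 < (F.erase ℓ).card by omega) m₁
  obtain ⟨hm₂ℓ, hm₂F⟩ := Finset.mem_erase.mp hm₂
  obtain ⟨h₂, h₂m, h₂le⟩ := hF m₂ hm₂F
  refine ⟨m₂, h₂, hm₂ℓ, h₂m, h₂le, fun _ => ?_⟩
  have h3 := finrank_sup_eq_three hℓ.1 hm.1 hne hmeet
  have hmeet₁ := inf_ne_bot_of_le_plane hℓ.1 h₁.1 h3 le_sup_left h₁le
  have hsup : ℓ ⊔ m₁ = ℓ ⊔ m := by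
    apply Submodule.eq_of_le_of_finrank_le (sup_le le_sup_left h₁le)
    rw [h3, finrank_sup_eq_three hℓ.1 h₁.1 hm₁ℓ.symm hmeet₁]
  obtain ⟨r, hr, hrm, hskew⟩ := h.skew ℓ m₁ hℓ h₁ hm₁ℓ.symm hmeet₁
  exact inf_eq_inf_of_third_lines h.smooth (by omega) hℓ h₁ hr hm₁ℓ.symm hmeet₁ hskew hrm
    (h.splits ℓ r hℓ hr hskew) h₂ hm₂ℓ hne₂ (hsup ▸ h₂le) hm hne.symm h₁m.symm
    (hsup ▸ le_sup_right)

theorem IsExtremal.grad_formula (h : IsExtremal f n) {ℓ r m : Submodule k (Fin 4 → k)}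
    (hℓ : IsLineOn f ℓ) (hr : IsLineOn f r) (hskew : ℓ ⊓ r = ⊥) (hm : IsLineOn f m)
    {e p p₂ : Fin 4 → k} (he0 : e ≠ 0) (hem : e ∈ m) (her : e ∈ r) (hpm : p ∈ m)
    (hpℓ : p ∈ ℓ) (hp₂ : p₂ ∈ ℓ) (hli : LinearIndependent k ![p, p₂]) :
    ∃ a b c : k, c ≠ 0 ∧ (a ≠ 0 ∨ b ≠ 0) ∧ (3 ≤ n → a = 0) ∧
      ∀ z w : k, grad f (z • p + w • p₂) e = c * w * (a * z + b * w) ^ (n - 1) := by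
  have hn := h.two_le
  have hp0 : p ≠ 0 := hli.ne_zero 0
  have hmeet : ℓ ⊓ m ≠ ⊥ := fun h => hp0 (by
    have : p ∈ ℓ ⊓ m := ⟨hpℓ, hpm⟩
    rw [h] at this
    exact this)
  have hne : ℓ ≠ m := by
    rintro rfl
    have : e ∈ ℓ ⊓ r := ⟨hem, her⟩
    rw [hskew] at this
    exact he0 this
  obtain ⟨m', hm', hm'ℓ, hm'm, hle, hstar⟩ := h.exists_third_line hℓ hm hne hmeet
  have hem' := not_mem_third_line h.smooth hℓ hm hr hm' hne hmeet hskew hm'm hle he0 hem her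
  have hshift := fun v (hv : v ∈ ℓ) =>
    exists_add_smul_mem h.smooth hℓ hm hr hm' hne hmeet hskew hm'm hle he0 hem her hv
  obtain ⟨a, ha⟩ := hshift p hpℓ
  obtain ⟨b, hb⟩ := hshift p₂ hp₂
  have hep : grad f e p = 0 := grad_eq_zero_of_mem hm.2 hem hpm
  refine ⟨a, b, -grad f e p₂, ?_, ?_, ?_, ?_⟩
  · rw [neg_ne_zero]
    intro h0
    obtain ⟨u, hu, hue⟩ := not_grad_zero_of_skew h.smooth hℓ.1 hr hskew her he0
    obtain ⟨s, t, rfl⟩ := mem_span_of_linearIndependent_pair hℓ.1 hli hpℓ hp₂ hu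
    apply hue
    rw [map_add, map_smul, map_smul, hep, h0]
    simp
  · by_contra! hab
    rw [hab.1, zero_smul, add_zero] at ha
    rw [hab.2, zero_smul, add_zero] at hb
    exact hm'ℓ (eq_of_common_pair hm'.1 hℓ.1 hli ha hb hpℓ hp₂)
  · intro h3
    by_contra ha0
    have hpm' : p ∈ m' := ((hstar h3).ge ⟨hpm, hpℓ⟩).1
    exact hem' ((m'.smul_mem_iff ha0).mp ((m'.add_mem_iff_right hpm').mp ha))
  · intro z w
    have hv : z • p + w • p₂ ∈ ℓ := ℓ.add_mem (ℓ.smul_mem _ hpℓ) (ℓ.smul_mem _ hp₂)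
    have hvc : z • p + w • p₂ + (a * z + b * w) • e ∈ m' := by
      have : z • p + w • p₂ + (a * z + b * w) • e = z • (p + a • e) + w • (p₂ + b • e) := by
        module
      rw [this]
      exact m'.add_mem (m'.smul_mem _ ha) (m'.smul_mem _ hb)
    by_cases hc : a * z + b * w = 0
    · rw [hc, zero_smul, add_zero] at hvc
      rw [grad_eq_zero_of_concurrent hℓ hm hm' hne hmeet hm'ℓ hle hem hv hvc, hc,
        zero_pow (by omega), mul_zero]
    · rw [(h.splits ℓ r hℓ hr hskew).grad_eq h.smooth (by omega) hm' her hv hc hvc, map_add,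
        map_smul, map_smul, hep, smul_zero, zero_add, smul_eq_mul]
      ring

/-- Two transversals of skew lines through a common point of one of them agree. -/
theorem eq_of_common_point (hf : IsSmoothSurface f (n + 1)) {ℓ r m m' : Submodule k (Fin 4 → k)}
    (hℓ : IsLineOn f ℓ) (hr : IsLineOn f r) (hskew : ℓ ⊓ r = ⊥) (hm : IsLineOn f m)
    (hm' : IsLineOn f m') (hmr : m ⊓ r ≠ ⊥) (hm'r : m' ⊓ r ≠ ⊥) {p : Fin 4 → k} (hp0 : p ≠ 0)
    (hpℓ : p ∈ ℓ) (hpm : p ∈ m) (hpm' : p ∈ m') : m = m' := by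
  obtain ⟨y, ⟨hym, hyr⟩, hy0⟩ := Submodule.exists_mem_ne_zero_of_ne_bot hmr
  obtain ⟨y', ⟨hym', hyr'⟩, hy0'⟩ := Submodule.exists_mem_ne_zero_of_ne_bot hm'r
  have hdep : ¬ LinearIndependent k ![y, y'] := by
    intro hli
    obtain ⟨u, hu, hne⟩ := not_grad_zero_of_skew hf hr.1 hℓ (by rw [inf_comm]; exact hskew)
      hpℓ hp0
    obtain ⟨s, t, rfl⟩ := mem_span_of_linearIndependent_pair hr.1 hli hyr hyr' hu
    apply hne
    rw [map_add, map_smul, map_smul, grad_eq_zero_of_mem hm.2 hpm hym,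
      grad_eq_zero_of_mem hm'.2 hpm' hym']
    simp
  rw [LinearIndependent.pair_iff' hy0] at hdep
  push Not at hdep
  obtain ⟨a, rfl⟩ := hdep
  exact eq_of_common_pair hm.1 hm'.1 (linearIndependent_pair_of_skew hskew hpℓ hyr' hp0 hy0')
    hpm (m.smul_mem a hym) hpm' hym'

end Extremal

section Main

theorem exists_coordinates {k : Type*} [Field k] {ℓ r : Submodule k (Fin 4 → k)}
    (hℓ : Module.finrank k ℓ = 2) (hr : Module.finrank k r = 2) (hskew : ℓ ⊓ r = ⊥)
    {e₁ e₂ e₃ e₄ : Fin 4 → k} (h₁ : e₁ ∈ r) (h₂ : e₂ ∈ r) (h₃ : e₃ ∈ ℓ) (h₄ : e₄ ∈ ℓ)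
    (h₁₂ : LinearIndependent k ![e₁, e₂]) (h₃₄ : LinearIndependent k ![e₃, e₄]) :
    ∃ x y z w : Module.Dual k (Fin 4 → k),
      ∀ v, v = z v • e₃ + w v • e₄ + (x v • e₁ + y v • e₂) := by
  have hspan : ⊤ ≤ Submodule.span k (Set.range ![e₁, e₂, e₃, e₄]) := by
    have hmem : ∀ i, ![e₁, e₂, e₃, e₄] i ∈ Submodule.span k (Set.range ![e₁, e₂, e₃, e₄]) :=
      fun i => Submodule.subset_span ⟨i, rfl⟩
    rw [← sup_eq_top_of_skew hℓ hr hskew]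
    apply sup_le
    · intro v hv
      obtain ⟨s, t, rfl⟩ := mem_span_of_linearIndependent_pair hℓ h₃₄ h₃ h₄ hv
      exact add_mem (Submodule.smul_mem _ s (hmem 2)) (Submodule.smul_mem _ t (hmem 3))
    · intro v hv
      obtain ⟨s, t, rfl⟩ := mem_span_of_linearIndependent_pair hr h₁₂ h₁ h₂ hv
      exact add_mem (Submodule.smul_mem _ s (hmem 0)) (Submodule.smul_mem _ t (hmem 1))
  let b := basisOfTopLeSpanOfCardEqFinrank ![e₁, e₂, e₃, e₄] hspan (by simp)
  refine ⟨b.coord 0, b.coord 1, b.coord 2, b.coord 3, fun v => ?_⟩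
  have h := b.sum_repr v
  rw [Fin.sum_univ_four] at h
  have hb : ∀ i, b i = ![e₁, e₂, e₃, e₄] i := fun i => by
    simp [b]
  rw [hb, hb, hb, hb] at h
  simp only [Module.Basis.coord_apply]
  conv_lhs => rw [← h]
  simp only [Matrix.cons_val]
  abel

variable {k : Type*} [Field k] [IsAlgClosed k] {f : MvPolynomial (Fin 4) k} {n : ℕ}

theorem exists_prod_eq_mul_mul (hn : 2 ≤ n) {a b c a' b' c' : k} (hc : c ≠ 0)
    (hab : a ≠ 0 ∨ b ≠ 0) (ha : 3 ≤ n → a = 0) (ha' : 3 ≤ n → a' = 0)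
    (x w z y : Module.Dual k (Fin 4 → k)) :
    ∃ h : Fin (n + 1) → Module.Dual k (Fin 4 → k), ∀ v,
      x v * w v * (c * (a * z v + b * w v) ^ (n - 1) + c' * (a' * y v + b' * x v) ^ (n - 1)) =
        ∏ i, h i v := by
  obtain ⟨n, rfl⟩ := Nat.exists_eq_add_of_le' (show 1 ≤ n by omega)
  rw [Nat.add_sub_cancel]
  have key : ∃ h : Fin n → Module.Dual k (Fin 4 → k), ∀ v,
      c * (a * z v + b * w v) ^ n + c' * (a' * y v + b' * x v) ^ n = ∏ i, h i v := by
    by_cases h3 : 3 ≤ n + 1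
    · have hb : b ≠ 0 := hab.resolve_left fun h => h (ha h3)
      obtain ⟨h, hh⟩ := exists_prod_eq_add_pow (mul_ne_zero hc (pow_ne_zero n hb)) (c' * b' ^ n)
        (show 0 < n by omega) x w
      refine ⟨h, fun v => ?_⟩
      rw [← hh, ha h3, ha' h3]
      ring
    · obtain rfl : n = 1 := by omega
      refine ⟨fun _ => c • (a • z + b • w) + c' • (a' • y + b' • x), fun v => ?_⟩
      simp [mul_add]
  obtain ⟨h, hh⟩ := key
  refine ⟨Fin.cons x (Fin.cons w h), fun v => ?_⟩
  rw [hh, Fin.prod_univ_succ, Fin.prod_univ_succ]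
  simp [mul_assoc]

theorem isExtremal_of_ncard (hf : IsSmoothSurface f (n + 1)) (hn : 2 ≤ n)
    (hcount : {W : Submodule k (Fin 4 → k) | IsLineOn f W}.ncard = n ^ 4 + n ^ 3 + n + 1) :
    IsExtremal f n := by
  obtain ⟨-, htrans, hplane⟩ := extremal_lines hf hn hcount
  refine ⟨hf, hn, fun ℓ r hℓ hr hskew => ?_, fun ℓ m hℓ hm hne hmeet =>
    (hplane ℓ m hℓ hm hne hmeet).1, fun ℓ m hℓ hm hne hmeet => (hplane ℓ m hℓ hm hne hmeet).2⟩
  obtain ⟨F, hcard, hF⟩ := htrans ℓ r hℓ hr hskew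
  exact (card_transversals hf hn hℓ hr hskew F hF).2 hcard

/-- The intersection points of two transversals with one of two skew lines are independent. -/
theorem linearIndependent_of_transversals (hf : IsSmoothSurface f (n + 1))
    {ℓ r m m' : Submodule k (Fin 4 → k)} (hℓ : IsLineOn f ℓ) (hr : IsLineOn f r)
    (hskew : ℓ ⊓ r = ⊥) (hm : IsLineOn f m) (hm' : IsLineOn f m') (hmr : m ⊓ r ≠ ⊥)
    (hm'r : m' ⊓ r ≠ ⊥) (hne : m ≠ m') {p p' : Fin 4 → k} (hp : p ≠ 0) (hp' : p' ≠ 0)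
    (hpm : p ∈ m) (hp'm' : p' ∈ m') (hp'ℓ : p' ∈ ℓ) :
    LinearIndependent k ![p, p'] := by
  rw [LinearIndependent.pair_iff' hp]
  rintro a rfl
  exact hne (eq_of_common_point hf hℓ hr hskew hm hm' hmr hm'r hp' hp'ℓ (m.smul_mem a hpm) hp'm')

theorem IsExtremal.isPrimePow_and_exists (h : IsExtremal f n)
    {ℓ r m₁ m₂ m₃ : Submodule k (Fin 4 → k)} (hℓ : IsLineOn f ℓ) (hr : IsLineOn f r)
    (hskew : ℓ ⊓ r = ⊥) (hm₁ : IsLineOn f m₁) (hm₁ℓ : m₁ ⊓ ℓ ≠ ⊥) (hm₁r : m₁ ⊓ r ≠ ⊥)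
    (hm₂ : IsLineOn f m₂) (hm₂ℓ : m₂ ⊓ ℓ ≠ ⊥) (hm₂r : m₂ ⊓ r ≠ ⊥)
    (hm₃ : IsLineOn f m₃) (hm₃ℓ : m₃ ⊓ ℓ ≠ ⊥) (hm₃r : m₃ ⊓ r ≠ ⊥)
    (h₁₂ : m₁ ≠ m₂) (h₁₃ : m₁ ≠ m₃) (h₂₃ : m₂ ≠ m₃) :
    IsPrimePow n ∧ ∃ H K : Fin (n + 1) → Submodule k (Fin 4 → k), IsNSCPairConfig f H K := by
  have hf := h.smooth
  have hskew' : r ⊓ ℓ = ⊥ := by rw [inf_comm, hskew]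
  obtain ⟨e₁, ⟨he₁m, he₁r⟩, he₁⟩ := Submodule.exists_mem_ne_zero_of_ne_bot hm₁r
  obtain ⟨e₂, ⟨he₂m, he₂r⟩, he₂⟩ := Submodule.exists_mem_ne_zero_of_ne_bot hm₂r
  obtain ⟨e₃, ⟨he₃m, he₃ℓ⟩, he₃⟩ := Submodule.exists_mem_ne_zero_of_ne_bot hm₁ℓ
  obtain ⟨e₄, ⟨he₄m, he₄ℓ⟩, he₄⟩ := Submodule.exists_mem_ne_zero_of_ne_bot hm₂ℓ
  have hli₁₂ := linearIndependent_of_transversals hf hr hℓ hskew' hm₁ hm₂ hm₁ℓ hm₂ℓ h₁₂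
    he₁ he₂ he₁m he₂m he₂r
  have hli₂₁ := linearIndependent_of_transversals hf hr hℓ hskew' hm₂ hm₁ hm₂ℓ hm₁ℓ h₁₂.symm
    he₂ he₁ he₂m he₁m he₁r
  have hli₃₄ := linearIndependent_of_transversals hf hℓ hr hskew hm₁ hm₂ hm₁r hm₂r h₁₂
    he₃ he₄ he₃m he₄m he₄ℓ
  have hli₄₃ := linearIndependent_of_transversals hf hℓ hr hskew hm₂ hm₁ hm₂r hm₁r h₁₂.symm
    he₄ he₃ he₄m he₃m he₃ℓ
  obtain ⟨a₁, b₁, c₁, hc₁, hab₁, ha₁, hD₁⟩ :=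
    h.grad_formula hℓ hr hskew hm₁ he₁ he₁m he₁r he₃m he₃ℓ he₄ℓ hli₃₄
  obtain ⟨a₂, b₂, c₂, hc₂, hab₂, ha₂, hD₂⟩ :=
    h.grad_formula hℓ hr hskew hm₂ he₂ he₂m he₂r he₄m he₄ℓ he₃ℓ hli₄₃
  obtain ⟨a₃, b₃, c₃, hc₃, hab₃, ha₃, hD₃⟩ :=
    h.grad_formula hr hℓ hskew' hm₁ he₃ he₃m he₃ℓ he₁m he₁r he₂r hli₁₂
  obtain ⟨a₄, b₄, c₄, hc₄, hab₄, ha₄, hD₄⟩ :=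
    h.grad_formula hr hℓ hskew' hm₂ he₄ he₄m he₄ℓ he₂m he₂r he₁r hli₂₁
  have hn := h.two_le
  constructor
  · rcases hn.eq_or_lt with rfl | h3
    · exact Nat.prime_two.isPrimePow
    obtain ⟨e, ⟨hem, her⟩, he⟩ := Submodule.exists_mem_ne_zero_of_ne_bot hm₃r
    obtain ⟨p, ⟨hpm, hpℓ⟩, hp⟩ := Submodule.exists_mem_ne_zero_of_ne_bot hm₃ℓ
    have hli := linearIndependent_of_transversals hf hℓ hr hskew hm₃ hm₂ hm₃r hm₂r h₂₃.symm
      hp he₄ hpm he₄m he₄ℓ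
    obtain ⟨a, b, c, hc, hab, ha, hD⟩ :=
      h.grad_formula hℓ hr hskew hm₃ he hem her hpm hpℓ he₄ℓ hli
    have hb : b ≠ 0 := hab.resolve_left fun h => h (ha h3)
    obtain ⟨s, t, rfl⟩ := mem_span_of_linearIndependent_pair hℓ.1 hli₃₄ he₃ℓ he₄ℓ hpℓ
    obtain ⟨x, y, rfl⟩ := mem_span_of_linearIndependent_pair hr.1 hli₁₂ he₁r he₂r her
    have ht : t ≠ 0 := by
      rintro rfl
      refine h₁₃ (eq_of_common_point hf hℓ hr hskew hm₁ hm₃ hm₁r hm₃r hp hpℓ ?_ hpm)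
      simpa using m₁.smul_mem s he₃m
    apply isPrimePow_of_binomial (a := x * (c₁ * b₁ ^ (n - 1)))
      (b := y * (c₂ * s * (b₂ * s) ^ (n - 1))) hn (mul_ne_zero hc (pow_ne_zero (n - 1) hb))
      (neg_ne_zero.mpr ht)
    intro w
    have e1 := hD 1 (w + -t)
    have e2 := hD₁ s w
    have e3 := hD₂ w s
    rw [add_comm (w • e₄)] at e3
    have e4 : (1 : k) • (s • e₃ + t • e₄) + (w + -t) • e₄ = s • e₃ + w • e₄ := by module
    rw [e4, map_add, map_smul, map_smul, e2, e3, ha h3, ha₁ h3, ha₂ h3] at e1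
    simp only [smul_eq_mul, zero_mul, zero_add] at e1
    obtain ⟨n, rfl⟩ := Nat.exists_eq_add_of_le' (show 1 ≤ n by omega)
    rw [Nat.add_sub_cancel] at *
    rw [mul_pow, mul_pow b (w + -t)] at e1
    linear_combination -e1
  · obtain ⟨x, y, z, w, hv⟩ :=
      exists_coordinates hℓ.1 hr.1 hskew he₁r he₂r he₃ℓ he₄ℓ hli₁₂ hli₃₄
    obtain ⟨g₁, hg₁⟩ := exists_prod_eq_mul_mul hn (b' := b₄) (c' := c₄) hc₁ hab₁ ha₁ ha₄ x w z y
    obtain ⟨g₂, hg₂⟩ := exists_prod_eq_mul_mul hn (b' := b₃) (c' := c₃) hc₂ hab₂ ha₂ ha₃ y z w x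
    refine ⟨_, _, isNSCPairConfig_of_eval_eq (by omega) hf (h := g₁) (g := g₂) fun v => ?_⟩
    have e4 := hD₄ (y v) (x v)
    have e2 := hD₂ (w v) (z v)
    rw [add_comm (y v • e₂)] at e4
    rw [add_comm (w v • e₄)] at e2
    conv_lhs => rw [hv v]
    rw [h.splits ℓ r hℓ hr hskew _ (add_mem (ℓ.smul_mem _ he₃ℓ) (ℓ.smul_mem _ he₄ℓ)) _
      (add_mem (r.smul_mem _ he₁r) (r.smul_mem _ he₂r)), map_add, map_add, map_smul, map_smul,
      map_smul, map_smul, hD₁, e2, hD₃, e4, ← hg₁, ← hg₂]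
    simp only [smul_eq_mul]
    ring

end Main

theorem max_lines_gives_nsc_config {k : Type*} [Field k] [IsAlgClosed k] (d : ℕ) (hd : 3 ≤ d)
    (f : MvPolynomial (Fin 4) k) (hf : IsSmoothSurface f d)
    (hcount : {W : Submodule k (Fin 4 → k) | IsLineOn f W}.ncard =
      d ^ 2 * (d ^ 2 - 3 * d + 3)) :
    IsPrimePow (d - 1) ∧
      ∃ H K : Fin d → Submodule k (Fin 4 → k), IsNSCPairConfig f H K := by
  obtain ⟨n, rfl⟩ := Nat.exists_eq_add_of_le' (show 1 ≤ d by omega)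
  rw [Nat.add_sub_cancel]
  have hn : 2 ≤ n := by omega
  have hcount' : {W : Submodule k (Fin 4 → k) | IsLineOn f W}.ncard = n ^ 4 + n ^ 3 + n + 1 := by
    obtain ⟨m, rfl⟩ := Nat.exists_eq_add_of_le' hn
    have : (m + 2 + 1) ^ 2 - 3 * (m + 2 + 1) = m ^ 2 + 3 * m := by
      rw [Nat.sub_eq_iff_eq_add (by nlinarith)]
      ring
    rw [hcount, this]
    ring
  have h := isExtremal_of_ncard hf hn hcount'
  obtain ⟨hskew, htrans, -⟩ := extremal_lines hf hn hcount'
  obtain ⟨ℓ, hℓ⟩ := Set.nonempty_of_ncard_ne_zero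
    (s := {W : Submodule k (Fin 4 → k) | IsLineOn f W}) (by omega)
  obtain ⟨r, hr, hℓr⟩ := hskew ℓ hℓ
  obtain ⟨F, hcard, hF⟩ := htrans ℓ r hℓ hr hℓr
  obtain ⟨m₁, m₂, m₃, h₁, h₂, h₃, h₁₂, h₁₃, h₂₃⟩ :=
    Finset.two_lt_card_iff.mp (show 2 < F.card by nlinarith)
  obtain ⟨hm₁, hm₁ℓ, hm₁r⟩ := hF m₁ h₁
  obtain ⟨hm₂, hm₂ℓ, hm₂r⟩ := hF m₂ h₂
  obtain ⟨hm₃, hm₃ℓ, hm₃r⟩ := hF m₃ h₃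
  exact h.isPrimePow_and_exists hℓ hr hℓr hm₁ hm₁ℓ hm₁r hm₂ hm₂ℓ hm₂r hm₃ hm₃ℓ hm₃r h₁₂ h₁₃ h₂₃
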